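/- arXiv:1808.04903 — 2 statements merged into one kernel-verified Lean document; each statement's English description precedes it below -/
import Mathlib

section
/- (Białynicki-Birula) Any effective regular action of the n-dimensional torus T_n on the affine space A^n over an algebraically closed field K is linearizable: there exists a polynomial automorphism β of A^n such that β⁻¹ ∘ σ(t) ∘ β is a linear map K^n → K^n for every t ∈ T_n. -/
/-- Evaluation of a (multivariate) Laurent polynomial `F` at a point `t` of the torus. -/
noncomputable def lEval {K : Type*} [Field K] {r : ℕ}
    (F : (Fin r → ℤ) →₀ K) (t : Fin r → Kˣ) : K :=
  F.sum fun m c => c * ∏ j, ((t j ^ m j : Kˣ) : K)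

/-- A map of affine `m`-space is a polynomial map if each component is given by a
polynomial in the coordinates. -/
def IsPolyMap {K : Type*} [CommSemiring K] {m : ℕ} (f : (Fin m → K) → (Fin m → K)) : Prop :=
  ∃ p : Fin m → MvPolynomial (Fin m) K, ∀ x i, f x i = MvPolynomial.eval x (p i)

/-- A regular torus action on affine space: each component of `σ t x` is a polynomial
in the coordinates `x` whose coefficients are Laurent polynomial functions of `t`. -/
def IsRegularAffineAction {K : Type*} [Field K] {r m : ℕ}
    (σ : (Fin r → Kˣ) → (Fin m → K) → (Fin m → K)) : Prop :=
  ∃ P : Fin m → ((Fin m →₀ ℕ) →₀ ((Fin r → ℤ) →₀ K)),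
    ∀ t x i, σ t x i = (P i).sum fun d F => lEval F t * ∏ j, x j ^ d j

open MvPolynomial in
/-- If a polynomial ring in `n` variables has a multiplicative basis indexed by a monoid, then it
is generated by at most `n` basis elements. -/
theorem mulBasis_generators {K : Type*} [Field K] {n : ℕ} {S : Type*} [AddCommMonoid S]
    (b : Module.Basis S K (MvPolynomial (Fin n) K)) (h0 : b 0 = 1)
    (hadd : ∀ s t, b (s + t) = b s * b t) :
    ∃ h : Fin n → MvPolynomial (Fin n) K, (∀ i, h i = 0 ∨ ∃ s, h i = b s) ∧
      Algebra.adjoin K (Set.range h) = ⊤ := by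
  classical
  have hd : ∀ s t, (b (s + t)).totalDegree = (b s).totalDegree + (b t).totalDegree := by
    intro s t
    rw [hadd, totalDegree_mul_of_isDomain (b.ne_zero s) (b.ne_zero t)]
  have hd0 : ∀ s, (b s).totalDegree = 0 → s = 0 := by
    intro s hs
    rw [totalDegree_eq_zero_iff_eq_C] at hs
    by_contra hne
    have h1 : b s = (coeff 0 (b s)) • b 0 := by
      rw [h0, smul_eq_C_mul, mul_one]; exact hs
    have h2 := congrArg (fun F => b.repr F s) h1
    simp [Finsupp.single_apply, Ne.symm hne] at h2
  let Irr : Set S := {s | s ≠ 0 ∧ ∀ a c, s = a + c → a = 0 ∨ c = 0}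
  -- generation
  have hgen : ∀ m : ℕ, ∀ s, (b s).totalDegree = m → b s ∈ Algebra.adjoin K (b '' Irr) := by
    intro m
    induction m using Nat.strong_induction_on with
    | _ m ih =>
      intro s hs
      by_cases hz : s = 0
      · rw [hz, h0]; exact one_mem _
      by_cases hi : s ∈ Irr
      · exact Algebra.subset_adjoin ⟨s, hi, rfl⟩
      · have : ∃ a c, s = a + c ∧ a ≠ 0 ∧ c ≠ 0 := by
          by_contra hcon
          push Not at hcon
          refine hi ⟨hz, fun a c hac => ?_⟩
          by_cases ha : a = 0
          · exact Or.inl ha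
          · exact Or.inr (hcon a c hac ha)
        obtain ⟨a, c, rfl, ha, hc⟩ := this
        have ha' : (b a).totalDegree ≠ 0 := fun h => ha (hd0 _ h)
        have hc' : (b c).totalDegree ≠ 0 := fun h => hc (hd0 _ h)
        rw [hd] at hs
        rw [hadd]
        exact mul_mem (ih _ (by omega) a rfl) (ih _ (by omega) c rfl)
  have htop : Algebra.adjoin K (b '' Irr) = ⊤ := by
    rw [eq_top_iff]
    intro F _
    have hF : F ∈ Submodule.span K (Set.range b) := by rw [b.span_eq]; trivial
    have : Submodule.span K (Set.range b) ≤
        Subalgebra.toSubmodule (Algebra.adjoin K (b '' Irr)) := by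
      rw [Submodule.span_le]
      rintro _ ⟨s, rfl⟩
      exact hgen _ s rfl
    exact this hF
  -- cardinality
  have hder : ∀ s ∈ Irr, ∀ F G, b.repr (F * G) s =
      b.repr F 0 * b.repr G s + b.repr G 0 * b.repr F s := by
    intro s hs F G
    have hF : F ∈ Submodule.span K (Set.range b) := by rw [b.span_eq]; trivial
    have hG : G ∈ Submodule.span K (Set.range b) := by rw [b.span_eq]; trivial
    induction hF using Submodule.span_induction with
    | zero => simp
    | add x y _ _ hx hy => rw [add_mul, map_add, map_add]; simp [hx, hy]; ring
    | smul a x _ hx => rw [smul_mul_assoc, map_smul, map_smul]; simp [hx]; ring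
    | mem x hx =>
      obtain ⟨u, rfl⟩ := hx
      induction hG using Submodule.span_induction with
      | zero => simp
      | add x y _ _ hx hy => rw [mul_add, map_add, map_add]; simp only [Finsupp.add_apply, hx, hy]; ring
      | smul a x _ hx =>
        rw [mul_smul_comm, map_smul, map_smul]; simp only [Finsupp.smul_apply, smul_eq_mul, hx]; ring
      | mem x hx =>
        obtain ⟨v, rfl⟩ := hx
        rw [← hadd]
        simp only [Module.Basis.repr_self, Finsupp.single_apply]
        by_cases huv : u + v = s
        · rcases hs.2 u v huv.symm with rfl | rfl
          · rw [zero_add] at huv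
            subst huv
            simp [hs.1]
          · rw [add_zero] at huv
            subst huv
            simp [hs.1]
        · by_cases hu : u = 0
          · subst hu
            rw [zero_add] at huv
            simp [huv, hs.1.symm]
          · by_cases hv : v = 0
            · subst hv
              rw [add_zero] at huv
              simp [huv, hs.1.symm]
            · simp [hu, hv, huv]
  have hcard : ∀ I : Finset S, (I : Set S) ⊆ Irr → I.card ≤ n := by
    intro I hI
    let D : MvPolynomial (Fin n) K →ₗ[K] (I → K) :=
      LinearMap.pi fun s => (Finsupp.lapply (s : S)) ∘ₗ b.repr.toLinearMap
    have hDapp : ∀ F s, D F s = b.repr F s := fun F s => rfl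
    have hDmul : ∀ F G, D (F * G) = b.repr F 0 • D G + b.repr G 0 • D F := by
      intro F G
      ext s
      simp [hDapp, hder s (hI s.2)]
    have hspan : ∀ F, D F ∈ Submodule.span K (Set.range fun i : Fin n => D (X i)) := by
      intro F
      induction F using MvPolynomial.induction_on with
      | C a =>
        have : D (C a) = 0 := by
          ext s
          have : (C a : MvPolynomial (Fin n) K) = a • b 0 := by
            rw [h0, smul_eq_C_mul, mul_one]
          rw [hDapp, this]
          simp [Finsupp.single_apply, (hI s.2).1.symm]
        rw [this]; exact zero_mem _
      | add p q hp hq => rw [map_add]; exact add_mem hp hq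
      | mul_X p i hp =>
        rw [hDmul]
        exact add_mem (Submodule.smul_mem _ _ (Submodule.subset_span ⟨i, rfl⟩))
          (Submodule.smul_mem _ _ hp)
    have hsurj : Submodule.span K (Set.range fun i : Fin n => D (X i)) = ⊤ := by
      rw [eq_top_iff, ← (Pi.basisFun K I).span_eq, Submodule.span_le]
      rintro _ ⟨s, rfl⟩
      have : (Pi.basisFun K I) s = D (b s) := by
        ext t
        rw [hDapp]
        simp only [Pi.basisFun_apply, Module.Basis.repr_self, Finsupp.single_apply, Pi.single_apply,
          Subtype.ext_iff]
        simp only [eq_comm]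
      rw [this]
      exact hspan _
    have := finrank_range_le_card (R := K) (fun i : Fin n => D (X i))
    rw [Set.finrank, hsurj, finrank_top] at this
    simpa using this
  have hfin : Irr.Finite := by
    by_contra hinf
    obtain ⟨I, hI, hIc⟩ := (Set.not_finite.mp hinf).exists_subset_card_eq (n + 1)
    have := hcard I hI
    omega
  have hc := hcard hfin.toFinset (by simp)
  have hcF : Fintype.card hfin.toFinset ≤ Fintype.card (Fin n) := by simpa using hc
  obtain ⟨e⟩ := Function.Embedding.nonempty_of_card_le hcF
  refine ⟨fun i => if h : ∃ s, e s = i then b (h.choose : S) else 0, fun i => ?_, ?_⟩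
  · by_cases h : ∃ s, e s = i
    · exact Or.inr ⟨(h.choose : S), by simp only [dif_pos h]⟩
    · exact Or.inl (by simp only [dif_neg h])
  · rw [eq_top_iff, ← htop]
    apply Algebra.adjoin_mono
    rintro _ ⟨s, hs, rfl⟩
    have hs' : s ∈ hfin.toFinset := by simpa using hs
    have h : ∃ u, e u = e ⟨s, hs'⟩ := ⟨_, rfl⟩
    refine ⟨e ⟨s, hs'⟩, ?_⟩
    simp only [dif_pos h]
    rw [e.injective h.choose_spec]

/-- The character of the torus attached to an integer vector. -/
def tch {K : Type*} [Field K] {n : ℕ} (χ : Fin n → ℤ) : (Fin n → Kˣ) →* K where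
  toFun t := ∏ j, ((t j ^ χ j : Kˣ) : K)
  map_one' := by simp
  map_mul' s t := by simp [mul_zpow, Finset.prod_mul_distrib]

theorem tch_apply {K : Type*} [Field K] {n : ℕ} (χ : Fin n → ℤ) (t : Fin n → Kˣ) :
    tch χ t = ∏ j, ((t j ^ χ j : Kˣ) : K) := rfl

theorem tch_add {K : Type*} [Field K] {n : ℕ} (χ ψ : Fin n → ℤ) (t : Fin n → Kˣ) :
    tch (χ + ψ) t = tch χ t * tch ψ t := by
  simp only [tch_apply, ← Finset.prod_mul_distrib]
  refine Finset.prod_congr rfl fun j _ => ?_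
  rw [Pi.add_apply, zpow_add, Units.val_mul]

theorem tch_zero {K : Type*} [Field K] {n : ℕ} (t : Fin n → Kˣ) :
    tch (0 : Fin n → ℤ) t = 1 := by
  simp [tch_apply]

theorem prod_zpow_eq_zpow_sum {G ι : Type*} [CommGroup G] (u : Finset ι) (f : ι → ℤ) (a : G) :
    ∏ i ∈ u, a ^ f i = a ^ ∑ i ∈ u, f i := by
  classical
  induction u using Finset.induction_on with
  | empty => simp
  | insert i u hi ih => rw [Finset.prod_insert hi, Finset.sum_insert hi, zpow_add, ih]

theorem zpow_all_one {K : Type*} [Field K] [Infinite K] (m : ℤ)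
    (h : ∀ s : Kˣ, s ^ m = 1) : m = 0 := by
  by_contra hm
  have hk : m.natAbs ≠ 0 := by simpa using hm
  have : NeZero m.natAbs := ⟨hk⟩
  have h' : ∀ s : Kˣ, s ^ m.natAbs = 1 := by
    intro s
    have := h s
    rcases Int.natAbs_eq m with h1 | h1
    · rw [h1, zpow_natCast] at this; exact this
    · rw [h1, zpow_neg, zpow_natCast, inv_eq_one] at this; exact this
  have htop : rootsOfUnity m.natAbs K = ⊤ := by
    rw [eq_top_iff]; intro s _; exact (mem_rootsOfUnity _ _).2 (h' s)
  have hfin : Finite (rootsOfUnity m.natAbs K) := inferInstance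
  rw [htop] at hfin
  have hU : Finite Kˣ := Finite.of_equiv _ (Subgroup.topEquiv (G := Kˣ)).toEquiv
  have hK : Finite K := by
    have : (Set.univ : Set K) ⊆ insert 0 (Set.range ((↑) : Kˣ → K)) := by
      intro x _
      by_cases hx : x = 0
      · exact Or.inl hx
      · exact Or.inr ⟨Units.mk0 x hx, rfl⟩
    exact Set.finite_univ_iff.1 (((Set.finite_range _).insert 0).subset this)
  exact not_finite K

theorem tch_injective {K : Type*} [Field K] [Infinite K] {n : ℕ} :
    Function.Injective (tch (K := K) (n := n)) := by
  classical
  intro χ ψ h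
  ext j
  have : χ j - ψ j = 0 := by
    apply zpow_all_one (K := K)
    intro s
    have h1 := DFunLike.congr_fun h (Pi.mulSingle j s)
    have key : ∀ χ : Fin n → ℤ, tch χ (Pi.mulSingle j s : Fin n → Kˣ) = ((s ^ χ j : Kˣ) : K) := by
      intro χ
      rw [tch_apply, Finset.prod_eq_single j]
      · simp
      · intro i _ hi
        simp [Pi.mulSingle_eq_of_ne hi]
      · simp
    rw [key, key] at h1
    rw [zpow_sub, Units.ext h1, mul_inv_cancel]
  omega

theorem tch_indep {K : Type*} [Field K] [Infinite K] {n : ℕ} (s : Finset (Fin n → ℤ))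
    (c : (Fin n → ℤ) → K) (h : ∀ t, ∑ χ ∈ s, c χ * tch χ t = 0) : ∀ χ ∈ s, c χ = 0 := by
  have h1 := (linearIndependent_monoidHom (Fin n → Kˣ) K).comp _ (tch_injective (K := K) (n := n))
  refine linearIndependent_iff'.1 h1 s c ?_
  ext t
  simpa using h t

theorem tch_indep_of_injective {K : Type*} [Field K] [Infinite K] {n : ℕ} {ι : Type*}
    (g : ι → Fin n → ℤ) (hg : Function.Injective g) (s : Finset ι)
    (c : ι → K) (h : ∀ t, ∑ i ∈ s, c i * tch (g i) t = 0) : ∀ i ∈ s, c i = 0 := by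
  have h1 := ((linearIndependent_monoidHom (Fin n → Kˣ) K).comp _
    (tch_injective (K := K) (n := n))).comp g hg
  refine linearIndependent_iff'.1 h1 s c ?_
  ext t
  simpa using h t

open MvPolynomial

/-- Semi-invariant polynomials of weight `χ`. -/
def IsWt {K : Type*} [Field K] {n : ℕ} (σ : (Fin n → Kˣ) → (Fin n → K) → (Fin n → K))
    (χ : Fin n → ℤ) (F : MvPolynomial (Fin n) K) : Prop :=
  ∀ t y, eval (σ t y) F = tch χ t * eval y F

theorem IsWt.one {K : Type*} [Field K] {n : ℕ} (σ : (Fin n → Kˣ) → (Fin n → K) → (Fin n → K)) :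
    IsWt σ 0 1 := by
  intro t y; simp [tch_zero]

theorem IsWt.mul {K : Type*} [Field K] {n : ℕ} {σ : (Fin n → Kˣ) → (Fin n → K) → (Fin n → K)}
    {χ ψ : Fin n → ℤ} {F G : MvPolynomial (Fin n) K} (hF : IsWt σ χ F) (hG : IsWt σ ψ G) :
    IsWt σ (χ + ψ) (F * G) := by
  intro t y; simp only [map_mul, tch_add, hF t y, hG t y]; ring

theorem IsWt.pow {K : Type*} [Field K] {n : ℕ} {σ : (Fin n → Kˣ) → (Fin n → K) → (Fin n → K)}
    {χ : Fin n → ℤ} {F : MvPolynomial (Fin n) K} (hF : IsWt σ χ F) (k : ℕ) :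
    IsWt σ (k • χ) (F ^ k) := by
  induction k with
  | zero => simpa using IsWt.one σ
  | succ k ih => rw [succ_nsmul, pow_succ]; exact ih.mul hF

theorem IsWt.prod {K : Type*} [Field K] {n : ℕ} {σ : (Fin n → Kˣ) → (Fin n → K) → (Fin n → K)}
    {ι : Type*} (s : Finset ι) {χ : ι → Fin n → ℤ} {F : ι → MvPolynomial (Fin n) K}
    (hF : ∀ i, IsWt σ (χ i) (F i)) : IsWt σ (∑ i ∈ s, χ i) (∏ i ∈ s, F i) := by
  classical
  induction s using Finset.induction_on with
  | empty => simpa using IsWt.one σ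
  | insert a s ha ih => rw [Finset.sum_insert ha, Finset.prod_insert ha]; exact (hF a).mul ih

theorem isWt_smul {K : Type*} [Field K] {n : ℕ} {σ : (Fin n → Kˣ) → (Fin n → K) → (Fin n → K)}
    {χ : Fin n → ℤ} {F : MvPolynomial (Fin n) K} (hF : IsWt σ χ F) (c : K) :
    IsWt σ χ (c • F) := by
  intro t y; simp only [smul_eval, hF t y]; ring

theorem isWt_sub {K : Type*} [Field K] {n : ℕ} {σ : (Fin n → Kˣ) → (Fin n → K) → (Fin n → K)}
    {χ : Fin n → ℤ} {F G : MvPolynomial (Fin n) K} (hF : IsWt σ χ F) (hG : IsWt σ χ G) :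
    IsWt σ χ (F - G) := by
  intro t y; simp only [map_sub, hF t y, hG t y]; ring

theorem wt_span {K : Type*} [Field K] [Infinite K] {n : ℕ}
    (σ : (Fin n → Kˣ) → (Fin n → K) → (Fin n → K))
    (hid : ∀ x, σ 1 x = x)
    (hcomp : ∀ t₁ t₂ x, σ t₁ (σ t₂ x) = σ (t₁ * t₂) x)
    (hreg : IsRegularAffineAction σ) :
    Submodule.span K {F : MvPolynomial (Fin n) K | ∃ χ, IsWt σ χ F} = ⊤ := by
  classical
  obtain ⟨P, hP⟩ := hreg
  have hX : ∀ i, (X i : MvPolynomial (Fin n) K) ∈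
      Submodule.span K {F : MvPolynomial (Fin n) K | ∃ χ, IsWt σ χ F} := by
    intro i
    let G : (Fin n → ℤ) → MvPolynomial (Fin n) K :=
      fun χ => ∑ d ∈ (P i).support, monomial d (P i d χ)
    let Q : Finset (Fin n → ℤ) := (P i).support.biUnion fun d => (P i d).support
    have hs : ∀ t y, σ t y i = ∑ χ ∈ Q, eval y (G χ) * tch χ t := by
      intro t y
      rw [hP, Finsupp.sum]
      simp only [G, map_sum, Finset.sum_mul]
      rw [Finset.sum_comm]
      refine Finset.sum_congr rfl fun d hd => ?_
      have : lEval (P i d) t = ∑ χ ∈ Q, P i d χ * tch χ t := by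
        rw [lEval, Finsupp.sum]
        apply Finset.sum_subset
        · exact Finset.subset_biUnion_of_mem (fun d => (P i d).support) hd
        · intro χ _ hχ
          simp [Finsupp.notMem_support_iff.1 hχ]
      rw [this, Finset.sum_mul]
      refine Finset.sum_congr rfl fun χ _ => ?_
      rw [eval_monomial, Finsupp.prod_fintype _ _ (by simp)]
      ring
    have hG : ∀ χ ∈ Q, IsWt σ χ (G χ) := by
      intro χ hχ t y
      have := tch_indep Q (fun χ => eval (σ t y) (G χ) - tch χ t * eval y (G χ)) (by
        intro s
        have h1 := hs s (σ t y)
        rw [hcomp, hs] at h1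
        simp only [sub_mul, Finset.sum_sub_distrib]
        rw [← h1, sub_eq_zero]
        refine Finset.sum_congr rfl fun χ _ => ?_
        rw [map_mul]; ring) χ hχ
      exact sub_eq_zero.1 this
    have hXi : (X i : MvPolynomial (Fin n) K) = ∑ χ ∈ Q, G χ := by
      apply MvPolynomial.funext
      intro y
      have := hs 1 y
      rw [hid] at this
      simpa using this
    rw [hXi]
    exact Submodule.sum_mem _ fun χ hχ => Submodule.subset_span ⟨χ, hG χ hχ⟩
  rw [eq_top_iff]
  intro F _
  induction F using MvPolynomial.induction_on with
  | C a =>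
    refine Submodule.subset_span ⟨0, ?_⟩
    intro t y; simp [tch_zero]
  | add p q hp hq => exact add_mem (hp trivial) (hq trivial)
  | mul_X p i hp =>
    have h := Submodule.mul_mem_mul (hp trivial) (hX i)
    rw [Submodule.span_mul_span] at h
    refine Submodule.span_mono ?_ h
    rintro _ ⟨A, ⟨χ, hA⟩, B, ⟨ψ, hB⟩, rfl⟩
    exact ⟨_, hA.mul hB⟩

theorem exists_indep_weights {K : Type*} [Field K] [Infinite K] {n : ℕ}
    (σ : (Fin n → Kˣ) → (Fin n → K) → (Fin n → K))
    (hspan : Submodule.span K {F : MvPolynomial (Fin n) K | ∃ χ, IsWt σ χ F} = ⊤)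
    (heff : ∀ t, t ≠ 1 → ∃ x, σ t x ≠ x) :
    ∃ (χ : Fin n → Fin n → ℤ) (f : Fin n → MvPolynomial (Fin n) K),
      (∀ i, f i ≠ 0) ∧ (∀ i, IsWt σ (χ i) (f i)) ∧
      Function.Injective (fun a : Fin n →₀ ℕ => ∑ i, a i • χ i) := by
  classical
  let q : (Fin n → ℤ) → (Fin n → ℚ) := fun χ j => (χ j : ℚ)
  let S : Set (Fin n → ℤ) := {χ | ∃ F : MvPolynomial (Fin n) K, F ≠ 0 ∧ IsWt σ χ F}
  have htop : Submodule.span ℚ (q '' S) = ⊤ := by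
    by_contra hne
    obtain ⟨φ, hφ0, hφ⟩ := Submodule.exists_le_ker_of_lt_top _ (lt_top_iff_ne_top.2 hne)
    obtain ⟨N, hN⟩ := IsLocalization.exist_integer_multiples_of_finite (nonZeroDivisors ℤ)
      (fun j : Fin n => φ (Pi.single j 1))
    choose l hl using hN
    have hl' : ∀ j, (l j : ℚ) = ((N : ℤ) : ℚ) * φ (Pi.single j 1) := by
      intro j
      have := hl j
      simpa [Submonoid.smul_def] using this
    have hN0 : ((N : ℤ) : ℚ) ≠ 0 := by exact_mod_cast nonZeroDivisors.coe_ne_zero N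
    have hφe : ∀ v : Fin n → ℚ, ((N : ℤ) : ℚ) * φ v = ∑ j, v j * (l j : ℚ) := by
      intro v
      conv_lhs => rw [← Finset.univ_sum_single v]
      rw [map_sum, Finset.mul_sum]
      refine Finset.sum_congr rfl fun j _ => ?_
      have : Pi.single j (v j) = v j • (Pi.single j 1 : Fin n → ℚ) := by
        rw [← Pi.single_smul]; simp
      rw [this, map_smul, hl', smul_eq_mul]; ring
    have hS : ∀ χ ∈ S, ∑ j, l j * χ j = 0 := by
      intro χ hχ
      have h1 : φ (q χ) = 0 := hφ (Submodule.subset_span ⟨χ, hχ, rfl⟩)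
      have h2 := hφe (q χ)
      rw [h1, mul_zero] at h2
      have h3 : ((∑ j, l j * χ j : ℤ) : ℚ) = 0 := by
        push_cast
        rw [h2]
        exact Finset.sum_congr rfl fun j _ => mul_comm _ _
      exact_mod_cast h3
    have hl0 : ∀ j, l j = 0 := by
      intro j
      apply zpow_all_one (K := K)
      intro s
      by_contra hs
      obtain ⟨x, hx⟩ := heff (fun j => s ^ l j) (fun h => hs (congrFun h j))
      apply hx
      have hall : ∀ F : MvPolynomial (Fin n) K, eval (σ (fun j => s ^ l j) x) F = eval x F := by
        intro F
        have hF : F ∈ Submodule.span K {F : MvPolynomial (Fin n) K | ∃ χ, IsWt σ χ F} := by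
          rw [hspan]; trivial
        induction hF using Submodule.span_induction with
        | zero => simp
        | add x y _ _ hx hy => simp [hx, hy]
        | smul a x _ hx => simp [smul_eval, hx]
        | mem F hF =>
          obtain ⟨χ, hF⟩ := hF
          by_cases hF0 : F = 0
          · simp [hF0]
          have hz := hS χ ⟨F, hF0, hF⟩
          rw [hF, tch_apply]
          simp only [← zpow_mul]
          rw [← Units.coe_prod, prod_zpow_eq_zpow_sum, hz]
          simp
      ext i
      simpa using hall (X i)
    apply hφ0
    ext v
    have := hφe (Pi.single v 1)
    simp only [hl0] at this
    simpa [hN0] using this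
  obtain ⟨B, hBS, hBspan, hBli⟩ := exists_linearIndependent ℚ (q '' S)
  rw [htop] at hBspan
  let bB : Module.Basis B ℚ (Fin n → ℚ) := Module.Basis.mk hBli (by simp [hBspan])
  let e : Fin n ≃ B := (Pi.basisFun ℚ (Fin n)).indexEquiv bB
  have hch : ∀ i : Fin n, ∃ χ, χ ∈ S ∧ q χ = e i := fun i => hBS (e i).2
  choose χ hχS hχ using hch
  choose f hf0 hf using hχS
  refine ⟨χ, f, hf0, hf, ?_⟩
  intro a a' h
  have hli : LinearIndependent ℚ (fun i => q (χ i)) := by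
    have h1 : LinearIndependent ℚ ((fun b : B => (b : Fin n → ℚ)) ∘ e) := hBli.comp e e.injective
    have h2 : (fun i => q (χ i)) = (fun b : B => (b : Fin n → ℚ)) ∘ e := by
      funext i; exact hχ i
    rw [h2]; exact h1
  have hz := Fintype.linearIndependent_iff.1 hli (fun i => (a i : ℚ) - (a' i : ℚ)) (by
    ext j
    have := congrFun h j
    simp only [Finset.sum_apply, Pi.smul_apply, nsmul_eq_mul] at this
    have h4 : ((∑ i, (a i : ℤ) * χ i j : ℤ) : ℚ) = ((∑ i, (a' i : ℤ) * χ i j : ℤ) : ℚ) := by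
      exact_mod_cast this
    push_cast at h4
    simp only [Finset.sum_apply, Pi.smul_apply, smul_eq_mul, Pi.zero_apply, sub_mul,
      Finset.sum_sub_distrib, q]
    rw [h4, sub_self])
  ext i
  have := sub_eq_zero.1 (hz i)
  exact_mod_cast this

theorem noeth_surj_endo_injective {R : Type*} [CommRing R] [IsNoetherianRing R] (f : R →+* R)
    (hf : Function.Surjective f) : Function.Injective f := by
  have hmono : Monotone fun k : ℕ => RingHom.ker (f ^ k) := by
    refine monotone_nat_of_le_succ fun k x hx => ?_
    rw [RingHom.mem_ker] at hx ⊢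
    rw [pow_succ', RingHom.mul_def, RingHom.comp_apply, hx, map_zero]
  obtain ⟨N, hN⟩ := monotone_stabilizes_iff_noetherian.2 (inferInstance : IsNoetherian R R)
    ⟨fun k : ℕ => RingHom.ker (f ^ k), hmono⟩
  rw [injective_iff_map_eq_zero]
  intro x hx
  have hs : Function.Surjective (f ^ N : R →+* R) := by
    rw [RingHom.coe_pow]; exact hf.iterate N
  obtain ⟨y, rfl⟩ := hs x
  have h1 : y ∈ RingHom.ker (f ^ (N + 1)) := by
    rw [RingHom.mem_ker, pow_succ', RingHom.mul_def, RingHom.comp_apply, hx]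
  have h2 : RingHom.ker (f ^ N) = RingHom.ker (f ^ (N + 1)) := hN (N + 1) (Nat.le_succ N)
  rw [← h2] at h1
  exact h1

theorem exists_dense_orbit {K : Type*} [Field K] [Infinite K] {n : ℕ}
    (σ : (Fin n → Kˣ) → (Fin n → K) → (Fin n → K))
    (hspan : Submodule.span K {F : MvPolynomial (Fin n) K | ∃ χ, IsWt σ χ F} = ⊤)
    (heff : ∀ t, t ≠ 1 → ∃ x, σ t x ≠ x) :
    ∃ x₀, ∀ F : MvPolynomial (Fin n) K, (∀ t, eval (σ t x₀) F = 0) → F = 0 := by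
  classical
  obtain ⟨χ, f, hf0, hf, hinj⟩ := exists_indep_weights σ hspan heff
  have hprod : ∏ i, f i ≠ 0 := Finset.prod_ne_zero_iff.2 fun i _ => hf0 i
  obtain ⟨x₀, hx₀⟩ : ∃ x₀, eval x₀ (∏ i, f i) ≠ 0 := by
    by_contra hcon
    push Not at hcon
    exact hprod (MvPolynomial.funext fun x => by simpa using hcon x)
  have hfx : ∀ i, eval x₀ (f i) ≠ 0 := by
    rw [map_prod] at hx₀
    exact fun i => Finset.prod_ne_zero_iff.1 hx₀ i (Finset.mem_univ i)
  have hB : ∀ p : MvPolynomial (Fin n) K, (∀ t, eval (σ t x₀) (aeval f p) = 0) → p = 0 := by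
    intro p hp
    have key := tch_indep_of_injective _ hinj p.support
      (fun a => coeff a p * eval x₀ (∏ i, f i ^ a i)) (by
        intro t
        rw [← hp t, aeval_def, eval₂_eq', map_sum]
        refine Finset.sum_congr rfl fun a _ => ?_
        have h1 := IsWt.prod (σ := σ) Finset.univ (fun i => (hf i).pow (a i)) t x₀
        rw [map_mul, h1, algebraMap_eq, eval_C]
        ring)
    ext a
    by_cases ha : a ∈ p.support
    · have h2 := key a ha
      have h3 : eval x₀ (∏ i, f i ^ a i) ≠ 0 := by
        rw [map_prod]
        exact Finset.prod_ne_zero_iff.2 fun i _ => by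
          rw [map_pow]; exact pow_ne_zero _ (hfx i)
      simpa using (mul_eq_zero.1 h2).resolve_right h3
    · simpa using ha
  have halg : AlgebraicIndependent K f := by
    rw [algebraicIndependent_iff]
    intro p hp
    exact hB p fun t => by rw [hp, map_zero]
  have htb : IsTranscendenceBasis K f := by
    apply halg.isTranscendenceBasis_of_lift_trdeg_le_of_finite
    rw [MvPolynomial.trdeg_of_isDomain]
    simp
  have hisalg := htb.isAlgebraic
  refine ⟨x₀, fun F hF => ?_⟩
  by_contra hF0
  obtain ⟨⟨r, hr⟩, hr0, hdvd⟩ :=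
    (hisalg.isAlgebraic F).exists_nonzero_dvd (mem_nonZeroDivisors_of_ne_zero hF0)
  rw [Algebra.adjoin_range_eq_range_aeval] at hr
  obtain ⟨p, hp⟩ := hr
  obtain ⟨G, hG⟩ := hdvd
  have hrG : r = F * G := hG
  have hp0 : p = 0 := by
    apply hB
    intro t
    change (aeval f) p = r at hp
    rw [hp, hrG, map_mul, hF, zero_mul]
  apply hr0
  ext1
  change (aeval f) p = r at hp
  change r = 0
  rw [← hp, hp0, map_zero]

theorem exists_wt_generators {K : Type*} [Field K] [Infinite K] {n : ℕ}
    (σ : (Fin n → Kˣ) → (Fin n → K) → (Fin n → K))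
    (hspan : Submodule.span K {F : MvPolynomial (Fin n) K | ∃ χ, IsWt σ χ F} = ⊤)
    (x₀ : Fin n → K)
    (hx₀ : ∀ F : MvPolynomial (Fin n) K, (∀ t, eval (σ t x₀) F = 0) → F = 0) :
    ∃ h : Fin n → MvPolynomial (Fin n) K, (∀ i, ∃ χ, IsWt σ χ (h i)) ∧
      Algebra.adjoin K (Set.range h) = ⊤ := by
  classical
  have huniq0 : ∀ χ F, IsWt σ χ F → eval x₀ F = 0 → F = 0 := by
    intro χ F hF h0
    exact hx₀ F fun t => by rw [hF, h0, mul_zero]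
  have huniq : ∀ χ F G, IsWt σ χ F → IsWt σ χ G → eval x₀ F = eval x₀ G → F = G := by
    intro χ F G hF hG h
    exact sub_eq_zero.1 (huniq0 χ _ (isWt_sub hF hG) (by rw [map_sub, h, sub_self]))
  let S : AddSubmonoid (Fin n → ℤ) :=
    { carrier := {χ | ∃ F : MvPolynomial (Fin n) K, F ≠ 0 ∧ IsWt σ χ F}
      zero_mem' := ⟨1, one_ne_zero, IsWt.one σ⟩
      add_mem' := by
        rintro χ ψ ⟨F, hF0, hF⟩ ⟨G, hG0, hG⟩
        exact ⟨F * G, mul_ne_zero hF0 hG0, hF.mul hG⟩ }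
  have hex : ∀ s : S, ∃ F, IsWt σ (s : Fin n → ℤ) F ∧ eval x₀ F = 1 := by
    rintro ⟨χ, F, hF0, hF⟩
    have hne : eval x₀ F ≠ 0 := fun h => hF0 (huniq0 χ F hF h)
    exact ⟨(eval x₀ F)⁻¹ • F, isWt_smul hF _, by rw [smul_eval, inv_mul_cancel₀ hne]⟩
  choose e he he1 using hex
  have hli : LinearIndependent K e := by
    rw [linearIndependent_iff']
    intro u c hc
    refine tch_indep_of_injective (fun s : S => (s : Fin n → ℤ)) Subtype.val_injective u c ?_
    intro t
    have := congrArg (eval (σ t x₀)) hc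
    simpa [smul_eval, he _ t x₀, he1] using this
  have hsp : ⊤ ≤ Submodule.span K (Set.range e) := by
    rw [← hspan, Submodule.span_le]
    rintro F ⟨χ, hF⟩
    by_cases hF0 : F = 0
    · rw [hF0]; exact zero_mem _
    · let s : S := ⟨χ, F, hF0, hF⟩
      have : F = eval x₀ F • e s :=
        huniq χ _ _ hF (isWt_smul (he s) _) (by rw [smul_eval, he1, mul_one])
      rw [this]
      exact Submodule.smul_mem _ _ (Submodule.subset_span ⟨s, rfl⟩)
  let b : Module.Basis S K (MvPolynomial (Fin n) K) := Module.Basis.mk hli hsp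
  have hb : ∀ s, b s = e s := fun s => Module.Basis.mk_apply hli hsp s
  obtain ⟨h, hh, hadj⟩ := mulBasis_generators b
    (by rw [hb]; exact huniq 0 _ _ (he 0) (IsWt.one σ) (by rw [he1, map_one]))
    (by
      intro s t
      rw [hb, hb, hb]
      exact huniq _ _ _ (he (s + t)) ((he s).mul (he t)) (by rw [map_mul, he1, he1, he1, mul_one]))
  refine ⟨h, fun i => ?_, hadj⟩
  rcases hh i with h0 | ⟨s, hs⟩
  · exact ⟨0, by rw [h0]; intro t y; simp⟩
  · exact ⟨s, by rw [hs, hb]; exact he s⟩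

/-- **(Białynicki-Birula)** Any effective regular action of the `n`-dimensional torus on
affine `n`-space over an algebraically closed field is linearizable. -/
theorem maximal_torus_action_on_affine_space_linearizable
    {K : Type*} [Field K] [IsAlgClosed K] (n : ℕ)
    (σ : (Fin n → Kˣ) → (Fin n → K) → (Fin n → K))
    (hid : ∀ x, σ 1 x = x)
    (hcomp : ∀ t₁ t₂ x, σ t₁ (σ t₂ x) = σ (t₁ * t₂) x)
    (hreg : IsRegularAffineAction σ)
    (heff : ∀ t, t ≠ 1 → ∃ x, σ t x ≠ x) :
    ∃ β γ : (Fin n → K) → (Fin n → K),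
      IsPolyMap β ∧ IsPolyMap γ ∧ (∀ x, γ (β x) = x) ∧ (∀ x, β (γ x) = x) ∧
      ∀ t, ∃ A : Matrix (Fin n) (Fin n) K, ∀ x, γ (σ t (β x)) = A.mulVec x := by
  classical
  have hinf : Infinite K := inferInstance
  have hspan := wt_span σ hid hcomp hreg
  obtain ⟨x₀, hx₀⟩ := exists_dense_orbit σ hspan heff
  obtain ⟨h, hwt, hadj⟩ := exists_wt_generators σ hspan x₀ hx₀
  choose χ hχ using hwt
  have hsurj : Function.Surjective (aeval h : MvPolynomial (Fin n) K →ₐ[K] _) := by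
    rw [← AlgHom.range_eq_top, ← Algebra.adjoin_range_eq_range_aeval, hadj]
  have hinj : Function.Injective (aeval h : MvPolynomial (Fin n) K →ₐ[K] _) :=
    noeth_surj_endo_injective
      (aeval h : MvPolynomial (Fin n) K →ₐ[K] MvPolynomial (Fin n) K).toRingHom hsurj
  let E : MvPolynomial (Fin n) K ≃ₐ[K] MvPolynomial (Fin n) K :=
    AlgEquiv.ofBijective (aeval h) ⟨hinj, hsurj⟩
  have hEX : ∀ i, E (X i) = h i := fun i => aeval_X h i
  have hγ : ∀ (x : Fin n → K) (p : MvPolynomial (Fin n) K),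
      eval (fun i => eval x (h i)) p = eval x (E p) := by
    intro x p
    change _ = eval x (aeval h p)
    induction p using MvPolynomial.induction_on with
    | C a => simp
    | add p q hp hq => simp [hp, hq]
    | mul_X p i hp => simp [hp]
  have hβ : ∀ (x : Fin n → K) (p : MvPolynomial (Fin n) K),
      eval (fun i => eval x (E.symm (X i))) p = eval x (E.symm p) := by
    intro x p
    induction p using MvPolynomial.induction_on with
    | C a =>
      have : E.symm (C a) = C a := E.symm.commutes a
      simp [this]
    | add p q hp hq => simp [hp, hq]
    | mul_X p i hp => simp [hp]
  have hγβ : ∀ x i, eval (fun i => eval x (E.symm (X i))) (h i) = x i := by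
    intro x i
    rw [hβ, ← hEX, AlgEquiv.symm_apply_apply, eval_X]
  refine ⟨fun x i => eval x (E.symm (X i)), fun x i => eval x (h i),
    ⟨_, fun _ _ => rfl⟩, ⟨_, fun _ _ => rfl⟩, fun x => funext fun i => hγβ x i, ?_, ?_⟩
  · intro x
    funext i
    dsimp only
    rw [hγ, AlgEquiv.apply_symm_apply, eval_X]
  · intro t
    refine ⟨Matrix.diagonal fun i => tch (χ i) t, fun x => funext fun i => ?_⟩
    dsimp only
    rw [hχ i, hγβ, Matrix.mulVec_diagonal]
end

section
/- (Gutwirth) Any effective regular action of a torus T_r (r ≥ 1) on the affine plane A² over an algebraically closed field K is linearizable: there exists a polynomial automorphism β of A² such that β⁻¹ ∘ σ(t) ∘ β is linear for every t ∈ T_r. -/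
open Polynomial in
lemma swap_coeff_coeff {K : Type*} [Field K] (G : K[X][X]) (i j : ℕ) :
    ((Polynomial.Bivariate.swap G).coeff j).coeff i = (G.coeff i).coeff j := by
  induction G using Polynomial.induction_on' with
  | add p q hp hq => simp [hp, hq]
  | monomial n f =>
    induction f using Polynomial.induction_on' with
    | add p q hp hq => simp only [map_add, coeff_add, hp, hq]
    | monomial m c =>
      rw [Polynomial.Bivariate.swap_monomial_monomial]
      simp only [coeff_monomial]
      split_ifs <;> simp_all [coeff_monomial]

open Polynomial in
lemma luroth_poly {K R : Type*} [Field K] [CommRing R] [IsDomain R] [IsIntegrallyClosed R]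
    [Algebra K R] (φ : R →ₐ[K] K[X]) (hφ : Function.Injective φ) (f0 : R)
    (hf0 : (φ f0).natDegree ≠ 0) : ∃ w : R, Algebra.adjoin K {w} = ⊤ := by
  let _ : Algebra R K[X] := φ.toRingHom.toAlgebra
  have hmap : ∀ a : R, algebraMap R K[X] a = φ a := fun a => rfl
  have : IsScalarTower K R K[X] := IsScalarTower.of_algebraMap_eq fun x => by
    rw [hmap, AlgHom.commutes]
  have : FaithfulSMul R K[X] := (faithfulSMul_iff_algebraMap_injective R K[X]).2 hφ
  have : Module.IsTorsionFree R K[X] := Module.isTorsionFree_iff_faithfulSMul.2 inferInstance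
  have key : ∀ (f : R), aeval (X : K[X]) ((φ f).map (algebraMap K R) - C f) = 0 := by
    intro f
    rw [map_sub, aeval_map_algebraMap, aeval_C, hmap, aeval_X_left_apply, sub_self]
  -- X is integral over R
  have hXint : IsIntegral R (X : K[X]) := by
    have hlc : (φ f0).leadingCoeff ≠ 0 := by
      intro h; rw [leadingCoeff_eq_zero] at h; simp [h] at hf0
    set F : R[X] := (φ f0).map (algebraMap K R) - C f0 with hF
    have hdeg : F.natDegree = (φ f0).natDegree := by
      rw [hF, natDegree_sub_C, natDegree_map]
    have hFl : F.leadingCoeff = algebraMap K R (φ f0).leadingCoeff := by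
      rw [leadingCoeff, hdeg, hF, coeff_sub, coeff_C, if_neg hf0, coeff_map, sub_zero]; rfl
    refine ⟨C (algebraMap K R (φ f0).leadingCoeff⁻¹) * F, ?_, ?_⟩
    · rw [Monic, leadingCoeff_mul, hFl, leadingCoeff_C, ← map_mul, inv_mul_cancel₀ hlc, map_one]
    · rw [← aeval_def, map_mul, key, mul_zero]
  set μ := minpoly R (X : K[X]) with hμ
  have hmon : μ.Monic := minpoly.monic hXint
  have hμ0 : aeval (X : K[X]) μ = 0 := minpoly.aeval _ _
  -- some coefficient is nonconstant
  obtain ⟨i, hi⟩ : ∃ i, (φ (μ.coeff i)).natDegree ≠ 0 := by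
    by_contra! hcon
    have h1 : ∀ i, φ (μ.coeff i) = C ((φ (μ.coeff i)).coeff 0) := fun i =>
      eq_C_of_natDegree_eq_zero (hcon i)
    have h2 : (∑ i ∈ Finset.range (μ.natDegree + 1),
        C ((φ (μ.coeff i)).coeff 0) * (X : K[X]) ^ i) = 0 := by
      rw [aeval_eq_sum_range] at hμ0
      rw [← hμ0]
      refine Finset.sum_congr rfl fun i _ => ?_
      rw [Algebra.smul_def, hmap, ← h1]
    have h3 := congrArg (fun p => coeff p μ.natDegree) h2
    simp only [finsetSum_coeff, coeff_C_mul, coeff_X_pow, coeff_zero] at h3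
    rw [Finset.sum_eq_single μ.natDegree] at h3
    · simp [hmon.coeff_natDegree] at h3
    · intro b _ hb; simp [hb.symm]
    · simp
  set w := μ.coeff i with hw
  set W := φ w with hW
  have hWlc : W.leadingCoeff ≠ 0 := by
    intro h; rw [leadingCoeff_eq_zero] at h; simp [h] at hi
  obtain ⟨H, hH⟩ := minpoly.isIntegrallyClosed_dvd hXint (key w)
  rw [← hμ, ← hW] at hH
  -- Move to K[X][X]
  have hH2 : W.map C - C W = μ.map φ.toRingHom * H.map φ.toRingHom := by
    rw [← Polynomial.map_mul, ← hH, Polynomial.map_sub, Polynomial.map_map, map_C]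
    congr 1
    · congr 1
      ext1 x
      simp [← Polynomial.algebraMap_eq]
  have hH3 := congrArg (Polynomial.Bivariate.swap) hH2
  rw [map_sub, map_mul, Bivariate.swap_map_C, Bivariate.swap_C] at hH3
  set G' := Bivariate.swap (μ.map φ.toRingHom) with hG'
  set H' := Bivariate.swap (H.map φ.toRingHom) with hH'
  have hd1 : (C W - W.map C : K[X][X]).natDegree = W.natDegree := by
    rw [← natDegree_neg, neg_sub, natDegree_sub_C, natDegree_map]
  have hne : (C W - W.map C : K[X][X]) ≠ 0 := by
    intro h; rw [h, natDegree_zero] at hd1; exact hi hd1.symm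
  have hG0 : G' ≠ 0 := by rintro h; rw [h, zero_mul] at hH3; exact hne hH3
  have hH0 : H' ≠ 0 := by rintro h; rw [h, mul_zero] at hH3; exact hne hH3
  have hd2 : W.natDegree ≤ G'.natDegree := by
    apply le_natDegree_of_ne_zero
    intro h
    have := swap_coeff_coeff (μ.map φ.toRingHom) i W.natDegree
    rw [← hG', h, coeff_map, coeff_zero] at this
    exact hWlc this.symm
  have hd3 : H'.natDegree = 0 := by
    have := natDegree_mul hG0 hH0
    rw [← hH3, hd1] at this
    omega
  have hlc : (C W - W.map C : K[X][X]).leadingCoeff = C (-W.leadingCoeff) := by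
    rw [leadingCoeff, hd1, coeff_sub, coeff_C, if_neg hi, coeff_map]
    simp
  have hunit : IsUnit H'.leadingCoeff := by
    have h1 : IsUnit (C (-W.leadingCoeff)) := isUnit_C.2 (by simpa using hWlc)
    rw [← hlc, hH3, leadingCoeff_mul] at h1
    exact isUnit_of_mul_isUnit_right h1
  obtain ⟨c, hcu, hc⟩ := isUnit_iff.1 hunit
  have hH'c : H' = C (C c) := by
    rw [eq_C_of_natDegree_eq_zero hd3, hc, leadingCoeff, hd3]
  have hHc : H = C (algebraMap K R c) := by
    have h1 : H.map φ.toRingHom = C (C c) := by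
      rw [← Bivariate.swap_swap_apply (H.map φ.toRingHom), ← hH', hH'c, Bivariate.swap_C_C]
    apply Polynomial.map_injective φ.toRingHom hφ
    rw [h1, map_C]
    simp [← Polynomial.algebraMap_eq]
  have hc0 : c ≠ 0 := hcu.ne_zero
  refine ⟨w, ?_⟩
  rw [eq_top_iff]
  rintro f -
  set B := Algebra.adjoin K {w} with hB
  have hwB : w ∈ B := Algebra.subset_adjoin rfl
  set ν : B[X] := C (algebraMap K B c⁻¹) * (W.map (algebraMap K B) - C ⟨w, hwB⟩) with hν
  have hνμ : ν.map (algebraMap B R) = μ := by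
    rw [hν, Polynomial.map_mul, Polynomial.map_sub, map_C, map_C, Polynomial.map_map,
      ← IsScalarTower.algebraMap_eq, ← IsScalarTower.algebraMap_apply]
    have : algebraMap B R ⟨w, hwB⟩ = w := rfl
    rw [this, hH, hHc, mul_comm μ, ← mul_assoc, ← C_mul, ← map_mul, inv_mul_cancel₀ hc0]
    simp
  have hinj : Function.Injective (algebraMap B R) := Subtype.val_injective
  have hνm : ν.Monic := by
    apply Polynomial.monic_of_injective hinj
    rw [hνμ]; exact hmon
  set F : B[X] := (φ f).map (algebraMap K B) with hF
  have hFm : F.map (algebraMap B R) = (φ f).map (algebraMap K R) := by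
    rw [hF, Polynomial.map_map, ← IsScalarTower.algebraMap_eq]
  set q := F %ₘ ν with hq
  have h5 : μ ∣ (q.map (algebraMap B R) - C f) := by
    have h6 := minpoly.isIntegrallyClosed_dvd hXint (key f)
    rw [← hμ, ← hFm, ← modByMonic_add_div F ν, Polynomial.map_add, Polynomial.map_mul, hνμ,
      add_sub_right_comm] at h6
    exact (dvd_add_left (dvd_mul_right _ _)).1 h6
  have hμd : 0 < μ.degree := minpoly.degree_pos hXint
  have h7 : (q.map (algebraMap B R) - C f) = 0 := by
    apply eq_zero_of_dvd_of_degree_lt h5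
    refine lt_of_le_of_lt (degree_sub_le _ _) (max_lt ?_ (lt_of_le_of_lt degree_C_le hμd))
    rw [← hνμ, degree_map_eq_of_injective hinj, degree_map_eq_of_injective hinj]
    exact degree_modByMonic_lt _ hνm
  have h8 : f = algebraMap B R (q.coeff 0) := by
    have := congrArg (fun p => coeff p 0) (sub_eq_zero.1 h7)
    simpa using this.symm
  rw [h8]
  exact (q.coeff 0).2

set_option linter.unusedSectionVars false
section graded
open DirectSum

variable {K A M : Type*} [Field K] [CommRing A] [IsDomain A] [Algebra K A] [AddCommGroup M]
  [DecidableEq M] (𝒜 : M → Submodule K A) [GradedAlgebra 𝒜]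

/-- The homogeneous component as a linear map. -/
noncomputable def pr (k : M) : A →ₗ[K] A := GradedAlgebra.proj 𝒜 k

lemma pr_mem (k : M) (a : A) : pr 𝒜 k a ∈ 𝒜 k := SetLike.coe_mem _

lemma pr_same {a : A} {m : M} (ha : a ∈ 𝒜 m) : pr 𝒜 m a = a :=
  decompose_of_mem_same 𝒜 ha

lemma pr_ne {a : A} {m n : M} (ha : a ∈ 𝒜 m) (h : m ≠ n) : pr 𝒜 n a = 0 :=
  decompose_of_mem_ne 𝒜 ha h

lemma pr_mul_left {a : A} {n : M} (ha : a ∈ 𝒜 n) (b : A) (k : M) :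
    pr 𝒜 k (a * b) = a * pr 𝒜 (k - n) b := by
  have h := coe_decompose_mul_add_of_left_mem 𝒜 (j := k - n) (b := b) ha
  rw [add_sub_cancel] at h
  exact h

lemma pr_mul_right {b : A} {n : M} (a : A) (hb : b ∈ 𝒜 n) (k : M) :
    pr 𝒜 k (a * b) = pr 𝒜 (k - n) a * b := by
  rw [mul_comm, pr_mul_left 𝒜 hb, mul_comm]

lemma pr_sum (a : A) : ∃ S : Finset M, (∀ k, k ∈ S ↔ pr 𝒜 k a ≠ 0) ∧ ∑ k ∈ S, pr 𝒜 k a = a := by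
  classical
  refine ⟨(decompose 𝒜 a).support, ?_, sum_support_decompose 𝒜 a⟩
  intro k
  rw [DFinsupp.mem_support_iff, Ne, Ne, ← Submodule.coe_eq_zero]
  rfl

lemma exists_pr_ne {a : A} (ha : a ≠ 0) : ∃ k, pr 𝒜 k a ≠ 0 := by
  by_contra! h
  obtain ⟨S, hS, hs⟩ := pr_sum 𝒜 a
  apply ha
  rw [← hs]
  exact Finset.sum_eq_zero fun k _ => h k

lemma mem_of_pr {a : A} {m : M} (h : ∀ k, k ≠ m → pr 𝒜 k a = 0) : a ∈ 𝒜 m := by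
  obtain ⟨S, hS, hs⟩ := pr_sum 𝒜 a
  rw [← hs]
  refine Submodule.sum_mem _ fun k hk => ?_
  by_cases hkm : k = m
  · rw [← hkm]; exact pr_mem 𝒜 _ _
  · rw [h k hkm]; exact Submodule.zero_mem _

lemma gr_sub_mem {a b : A} {m n : M} (ha : a ∈ 𝒜 n) (ha0 : a ≠ 0) (hab : a * b ∈ 𝒜 m) :
    b ∈ 𝒜 (m - n) := by
  apply mem_of_pr
  intro k hk
  have h1 : pr 𝒜 (k + n) (a * b) = 0 := by
    apply pr_ne 𝒜 hab
    rintro rfl; apply hk; abel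
  rw [pr_mul_left 𝒜 ha, add_sub_cancel_right] at h1
  exact (mul_eq_zero.1 h1).resolve_left ha0

lemma gr_deg_unique {a : A} {m n : M} (h1 : a ∈ 𝒜 m) (h2 : a ∈ 𝒜 n) (h0 : a ≠ 0) : m = n :=
  degree_eq_of_mem_mem 𝒜 h1 h2 h0

lemma pr_mul_unique {a b : A} {m n : M}
    (h : ∀ i j, pr 𝒜 i a ≠ 0 → pr 𝒜 j b ≠ 0 → i + j = m + n → i = m ∧ j = n) :
    pr 𝒜 (m + n) (a * b) = pr 𝒜 m a * pr 𝒜 n b := by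
  obtain ⟨S, hS, hs⟩ := pr_sum 𝒜 a
  conv_lhs => rw [← hs, Finset.sum_mul, map_sum]
  simp_rw [pr_mul_left 𝒜 (pr_mem 𝒜 _ _)]
  rw [Finset.sum_eq_single m]
  · rw [add_sub_cancel_left]
  · intro i hi him
    by_contra hne
    have := h i (m + n - i) ((hS i).1 hi) (right_ne_zero_of_mul hne) (by abel)
    exact him this.1
  · intro hm
    have : pr 𝒜 m a = 0 := by by_contra h; exact hm ((hS m).2 h)
    rw [this, zero_mul]

lemma gr_factor [TwoUniqueSums M] {a b : A} {m : M} (h0 : a * b ≠ 0) (hab : a * b ∈ 𝒜 m) :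
    ∃ n, a ∈ 𝒜 n ∧ b ∈ 𝒜 (m - n) := by
  classical
  have ha0 : a ≠ 0 := left_ne_zero_of_mul h0
  have hb0 : b ≠ 0 := right_ne_zero_of_mul h0
  suffices ∃ n, a ∈ 𝒜 n by
    obtain ⟨n, hn⟩ := this
    exact ⟨n, hn, gr_sub_mem 𝒜 hn ha0 hab⟩
  obtain ⟨S, hS, hs⟩ := pr_sum 𝒜 a
  obtain ⟨T, hT, ht⟩ := pr_sum 𝒜 b
  have hTn : T.Nonempty := by
    obtain ⟨k, hk⟩ := exists_pr_ne 𝒜 hb0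
    exact ⟨k, (hT k).2 hk⟩
  have key : ∀ s ∈ S, ∀ t ∈ T, UniqueAdd S T s t → s + t = m := by
    intro s hs t ht hu
    by_contra hne
    have h1 : pr 𝒜 (s + t) (a * b) = 0 := pr_ne 𝒜 hab (Ne.symm hne)
    rw [pr_mul_unique 𝒜] at h1
    · rcases mul_eq_zero.1 h1 with h | h
      · exact (hS s).1 hs h
      · exact (hT t).1 ht h
    · intro i j hi hj hij
      exact hu ((hS i).2 hi) ((hT j).2 hj) hij
  have hcard : S.card ≤ 1 := by
    by_contra! hlt
    have h2 : 1 < S.card * T.card := by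
      have := hTn.card_pos
      nlinarith
    obtain ⟨p, hp, q, hq, hpq, h3, h4⟩ := TwoUniqueSums.uniqueAdd_of_one_lt_card h2
    rw [Finset.mem_product] at hp hq
    have h5 := key _ hp.1 _ hp.2 h3
    have h6 := key _ hq.1 _ hq.2 h4
    have h7 := h3 hq.1 hq.2 (h6.trans h5.symm)
    exact hpq (Prod.ext h7.1.symm h7.2.symm)
  obtain ⟨n, hn⟩ := exists_pr_ne 𝒜 ha0
  refine ⟨n, mem_of_pr 𝒜 fun k hk => ?_⟩
  by_contra hne
  exact hk (Finset.card_le_one.1 hcard k ((hS k).2 hne) n ((hS n).2 hn))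

lemma gr_transc {N : AddSubgroup M} {B : Subalgebra K A}
    (hB : ∀ b ∈ B, ∀ k, k ∉ N → pr 𝒜 k b = 0) {m : M}
    (hm : ∀ k : ℤ, k • m ∈ N → k = 0) {P : A} (hP : P ∈ 𝒜 m) (hP0 : P ≠ 0) :
    Transcendental B P := by
  rw [transcendental_iff]
  intro p hp
  by_contra hp0
  obtain ⟨i, hi⟩ : ∃ i, p.coeff i ≠ 0 := by
    by_contra! h; exact hp0 (Polynomial.ext (by simpa using h))
  obtain ⟨n, hn⟩ : ∃ n, pr 𝒜 n (p.coeff i : A) ≠ 0 :=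
    exists_pr_ne 𝒜 (by exact_mod_cast hi)
  have hnN : n ∈ N := by
    by_contra h; exact hn (hB _ (p.coeff i).2 n h)
  rw [Polynomial.aeval_eq_sum_range] at hp
  have h1 := congrArg (pr 𝒜 (n + (i : ℤ) • m)) hp
  rw [map_sum, map_zero] at h1
  have h2 : ∀ j : ℕ, pr 𝒜 (n + (i : ℤ) • m) (p.coeff j • P ^ j)
      = pr 𝒜 (n + ((i : ℤ) - j) • m) (p.coeff j : A)  * P ^ j := by
    intro j
    have hPj : P ^ j ∈ 𝒜 (j • m) := SetLike.pow_mem_graded j hP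
    have : n + ((i : ℤ) - j) • m = n + (i : ℤ) • m - j • m := by
      rw [sub_smul, natCast_zsmul, natCast_zsmul]; abel
    rw [this, ← pr_mul_right 𝒜 _ hPj]; rfl
  simp_rw [h2] at h1
  rw [Finset.sum_eq_single i] at h1
  · rw [sub_self, zero_smul, add_zero] at h1
    exact hn ((mul_eq_zero.1 h1).resolve_right (pow_ne_zero _ hP0))
  · intro j _ hji
    rw [hB _ (p.coeff j).2, zero_mul]
    intro hmem
    have h3 : ((i : ℤ) - j) • m ∈ N := by
      have := N.sub_mem hmem hnN
      simpa using this
    have := hm _ h3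
    omega
  · intro hi'
    exfalso
    apply hi
    apply Polynomial.coeff_eq_zero_of_natDegree_lt
    simpa using hi'
end graded

set_option linter.unusedSectionVars false

lemma mem_range_of_algebraic {K B : Type*} [Field K] [IsAlgClosed K] [CommRing B] [IsDomain B]
    [Algebra K B] {z : B} (hz : IsAlgebraic K z) : ∃ c : K, algebraMap K B c = z := by
  have hi : IsIntegral K z := hz.isIntegral
  exact minpoly.mem_range_of_degree_eq_one K z
    (IsAlgClosed.degree_eq_one_of_irreducible K (minpoly.irreducible hi))

lemma three_false {K : Type*} [Field K] {a b c : MvPolynomial (Fin 2) K}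
    (ha : Transcendental K a) (hb : Transcendental (Algebra.adjoin K {a}) b)
    (hc : Transcendental (Algebra.adjoin K {b, a}) c) : False := by
  have h1 : AlgebraicIndependent K (fun _ : Unit => a) :=
    algebraicIndependent_unique_type_iff.2 ha
  have h2 := (h1.option_iff_transcendental b).2 (by rw [Set.range_const]; exact hb)
  have h3 := (h2.option_iff_transcendental c).2 (by
    have : Set.range (fun o : Option Unit => o.elim b fun _ => a) = {b, a} := by
      ext x
      constructor
      · rintro ⟨_ | _, rfl⟩ <;> simp
      · rintro (rfl | rfl)
        · exact ⟨none, rfl⟩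
        · exact ⟨some (), rfl⟩
    rw [this]; exact hc)
  have h4 := h3.lift_cardinalMk_le_trdeg
  rw [MvPolynomial.trdeg_of_isDomain] at h4
  simp only [Cardinal.mk_fintype, Fintype.card_option, Fintype.card_unit, Fintype.card_fin,
    Cardinal.lift_natCast] at h4
  have : (1 + 1 + 1 : ℕ) ≤ 2 := by exact_mod_cast h4
  omega

section fix
open DirectSum
variable {K M : Type*} [Field K] [IsAlgClosed K] [AddCommGroup M]
  [DecidableEq M] [IsAddTorsionFree M] [TwoUniqueSums M]
  (𝒜 : M → Submodule K (MvPolynomial (Fin 2) K)) [GradedAlgebra 𝒜]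

/-- The degree zero subalgebra. -/
def A0 : Subalgebra K (MvPolynomial (Fin 2) K) where
  carrier := 𝒜 0
  mul_mem' {a b} ha hb := by
    have := SetLike.GradedMul.mul_mem (A := 𝒜) ha hb
    rwa [add_zero] at this
  add_mem' ha hb := (𝒜 0).add_mem ha hb
  algebraMap_mem' c := by
    rw [Algebra.algebraMap_eq_smul_one]
    exact (𝒜 0).smul_mem _ SetLike.GradedOne.one_mem

lemma mem_A0 {a : MvPolynomial (Fin 2) K} : a ∈ A0 𝒜 ↔ a ∈ 𝒜 0 := Iff.rfl

lemma C_mem (c : K) : MvPolynomial.C c ∈ 𝒜 0 := (A0 𝒜).algebraMap_mem c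

lemma transc_of_not_const {w : MvPolynomial (Fin 2) K} (hw : ∀ c, w ≠ MvPolynomial.C c) :
    Transcendental K w := by
  intro h
  obtain ⟨c, hc⟩ := mem_range_of_algebraic h
  exact hw c hc.symm

lemma alg_A0 {m : M} (hm : m ≠ 0) {P w f : MvPolynomial (Fin 2) K} (hP : P ∈ 𝒜 m) (hP0 : P ≠ 0)
    (hw : w ∈ 𝒜 0) (hwc : ∀ c, w ≠ MvPolynomial.C c) (hf : f ∈ 𝒜 0) :
    IsAlgebraic (Algebra.adjoin K {w}) f := by
  by_contra h
  refine three_false (transc_of_not_const hwc) h (c := P) ?_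
  refine gr_transc 𝒜 (N := ⊥) (m := m) ?_ ?_ hP hP0
  · intro b hb k hk
    have : Algebra.adjoin K {f, w} ≤ A0 𝒜 := by
      rw [Algebra.adjoin_le_iff]
      rintro x (rfl | rfl) <;> assumption
    refine pr_ne 𝒜 (this hb) ?_
    rintro rfl; exact hk (AddSubgroup.zero_mem _)
  · intro k hk
    rw [AddSubgroup.mem_bot, smul_eq_zero] at hk
    exact hk.resolve_right hm

lemma dep_weights {m n : M} {P w f : MvPolynomial (Fin 2) K} (hP : P ∈ 𝒜 m) (hP0 : P ≠ 0)
    (hw : w ∈ 𝒜 0) (hwc : ∀ c, w ≠ MvPolynomial.C c) (hf : f ∈ 𝒜 n) (hf0 : f ≠ 0) (hm : m ≠ 0) :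
    ∃ a b : ℤ, b ≠ 0 ∧ a • m + b • n = 0 := by
  by_contra! hcon
  refine three_false (transc_of_not_const hwc) (b := P) (c := f) ?_ ?_
  · refine gr_transc 𝒜 (N := ⊥) (m := m) ?_ ?_ hP hP0
    · intro b hb k hk
      have : Algebra.adjoin K {w} ≤ A0 𝒜 := by
        rw [Algebra.adjoin_le_iff]
        rintro x rfl; assumption
      refine pr_ne 𝒜 (this hb) ?_
      rintro rfl; exact hk (AddSubgroup.zero_mem _)
    · intro k hk
      rw [AddSubgroup.mem_bot, smul_eq_zero] at hk
      exact hk.resolve_right hm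
  · refine gr_transc 𝒜 (N := AddSubgroup.zmultiples m) (m := n) ?_ ?_ hf hf0
    · intro b hb
      induction hb using Algebra.adjoin_induction with
      | mem x hx =>
        intro k hk
        rcases hx with rfl | rfl
        · refine pr_ne 𝒜 hP ?_
          rintro rfl; exact hk (AddSubgroup.mem_zmultiples _)
        · refine pr_ne 𝒜 hw ?_
          rintro rfl; exact hk (AddSubgroup.zero_mem _)
      | algebraMap c =>
        intro k hk
        refine pr_ne 𝒜 (C_mem 𝒜 c) ?_
        rintro rfl; exact hk (AddSubgroup.zero_mem _)
      | add x y _ _ hx hy => intro k hk; rw [map_add, hx k hk, hy k hk, add_zero]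
      | mul x y _ _ hx hy =>
        intro k hk
        obtain ⟨S, hS, hs⟩ := pr_sum 𝒜 x
        rw [← hs, Finset.sum_mul, map_sum]
        refine Finset.sum_eq_zero fun j hj => ?_
        rw [pr_mul_left 𝒜 (pr_mem 𝒜 _ _)]
        by_cases hjm : j ∈ AddSubgroup.zmultiples m
        · rw [hy, mul_zero]
          intro h
          apply hk
          have := AddSubgroup.add_mem _ h hjm
          simpa using this
        · rw [hx j hjm, zero_mul]
    · intro k hk
      obtain ⟨l, hl⟩ := AddSubgroup.mem_zmultiples_iff.1 hk
      by_contra hk0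
      exact hcon (-l) k hk0 (by rw [neg_smul, hl]; simp)

lemma A0_intClosed : IsIntegrallyClosed (A0 𝒜) := by
  let F := FractionRing (MvPolynomial (Fin 2) K)
  rw [isIntegrallyClosed_iff (FractionRing (A0 𝒜))]
  intro x hx
  have hinj : Function.Injective (algebraMap (A0 𝒜) F) := by
    rw [IsScalarTower.algebraMap_eq (A0 𝒜) (MvPolynomial (Fin 2) K) F]
    exact (IsFractionRing.injective (MvPolynomial (Fin 2) K) F).comp Subtype.val_injective
  let ψ : FractionRing (A0 𝒜) →ₐ[A0 𝒜] F := IsFractionRing.liftAlgHom (g := Algebra.ofId _ _) hinj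
  have h1 : IsIntegral (A0 𝒜) (ψ x) := hx.map ψ
  have h2 : IsIntegral (MvPolynomial (Fin 2) K) (ψ x) := h1.tower_top
  obtain ⟨y, hy⟩ := IsIntegrallyClosed.isIntegral_iff.1 h2
  obtain ⟨a, b, hb, hab⟩ := IsFractionRing.div_surjective (A := A0 𝒜) x
  have hb0 : b ≠ 0 := nonZeroDivisors.ne_zero hb
  have hb1 : algebraMap (A0 𝒜) (FractionRing (A0 𝒜)) b ≠ 0 := by
    intro h
    exact hb0 (IsFractionRing.injective (A0 𝒜) (FractionRing (A0 𝒜)) (h.trans (map_zero _).symm))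
  have h3 : x * algebraMap _ _ b = algebraMap _ _ a := by
    rw [← hab, div_mul_cancel₀ _ hb1]
  have h4 := congrArg ψ h3
  rw [map_mul, AlgHom.commutes, AlgHom.commutes, ← hy] at h4
  have e1 := IsScalarTower.algebraMap_apply (A0 𝒜) (MvPolynomial (Fin 2) K) F a
  have e2 := IsScalarTower.algebraMap_apply (A0 𝒜) (MvPolynomial (Fin 2) K) F b
  rw [e1, e2, ← map_mul] at h4
  have h5 : y * (b : MvPolynomial (Fin 2) K) = a :=
    IsFractionRing.injective (MvPolynomial (Fin 2) K) F h4
  have h6 : y ∈ 𝒜 0 := by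
    have hbb : (b : MvPolynomial (Fin 2) K) ∈ 𝒜 0 := b.2
    have := gr_sub_mem 𝒜 (m := 0) hbb (by exact_mod_cast hb0) (b := y)
      (by rw [mul_comm, h5]; exact a.2)
    rwa [sub_zero] at this
  refine ⟨⟨y, h6⟩, ?_⟩
  rw [← hab, eq_div_iff hb1, ← map_mul]
  congr 1
  exact Subtype.ext h5

open Polynomial in
lemma A0_gen {m : M} (hm : m ≠ 0) {P w0 : MvPolynomial (Fin 2) K} (hP : P ∈ 𝒜 m) (hP0 : P ≠ 0)
    (hw : w0 ∈ 𝒜 0) (hwc : ∀ c, w0 ≠ MvPolynomial.C c) :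
    ∃ w ∈ 𝒜 0, ∀ f ∈ 𝒜 0, ∃ G : K[X], f = aeval w G := by
  have := A0_intClosed 𝒜
  obtain ⟨p, q, hpq⟩ : ∃ p q, MvPolynomial.eval p w0 ≠ MvPolynomial.eval q w0 := by
    by_contra! h
    apply hwc (MvPolynomial.eval 0 w0)
    apply MvPolynomial.funext
    intro x
    rw [MvPolynomial.eval_C]
    exact h _ _
  let φ : MvPolynomial (Fin 2) K →ₐ[K] K[X] :=
    MvPolynomial.aeval (fun i => C (p i) + C (q i - p i) * X)
  have hev : ∀ (t : K) f, (φ f).eval t = MvPolynomial.eval (fun i => p i + (q i - p i) * t) f := by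
    intro t f
    induction f using MvPolynomial.induction_on with
    | C a => simp [φ]
    | add f g hf hg => simp [hf, hg]
    | mul_X f i hf => simp [hf]; left; simp [φ]
  have hd : (φ w0).natDegree ≠ 0 := by
    intro h
    rw [natDegree_eq_zero] at h
    obtain ⟨c, hc⟩ := h
    apply hpq
    have h0 := hev 0 w0
    have h1 := hev 1 w0
    rw [← hc, eval_C] at h0 h1
    simp only [mul_zero, add_zero, mul_one, add_sub_cancel] at h0 h1
    exact h0.symm.trans h1
  let φ0 : A0 𝒜 →ₐ[K] K[X] := φ.comp (A0 𝒜).val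
  have hinj : Function.Injective φ0 := by
    rw [injective_iff_map_eq_zero]
    intro g hg
    by_contra hg0
    -- relation of g over K[w0]
    have halg := alg_A0 𝒜 hm hP hP0 hw hwc g.2
    let B := Algebra.adjoin K {w0}
    have hne := Ideal.comap_ne_bot_of_algebraic_mem (R := B) (I := RingHom.ker φ.toRingHom)
      (x := (g : MvPolynomial (Fin 2) K)) (by exact_mod_cast hg0) hg halg
    rw [Submodule.ne_bot_iff] at hne
    obtain ⟨b, hb, hb0⟩ := hne
    have hb2 : (b : MvPolynomial (Fin 2) K) ∈ Algebra.adjoin K {w0} := b.2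
    rw [Algebra.adjoin_singleton_eq_range_aeval] at hb2
    obtain ⟨h, hh⟩ := hb2
    have hb' : φ b = 0 := hb
    have hh' : aeval w0 h = b := hh
    rw [← hh', ← aeval_algHom_apply] at hb'
    have hh0 : h ≠ 0 := by
      rintro rfl
      rw [map_zero] at hh'
      exact hb0 (Subtype.ext hh'.symm)
    obtain ⟨c, hc⟩ := mem_range_of_algebraic (⟨h, hh0, hb'⟩ : IsAlgebraic K (φ w0))
    apply hd
    rw [← hc]; exact natDegree_C c
  obtain ⟨w, hwtop⟩ := luroth_poly φ0 hinj ⟨w0, hw⟩ hd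
  refine ⟨w, w.2, fun f hf => ?_⟩
  have : (⟨f, hf⟩ : A0 𝒜) ∈ Algebra.adjoin K {w} := by rw [hwtop]; trivial
  rw [Algebra.adjoin_singleton_eq_range_aeval] at this
  obtain ⟨G, hG⟩ := this
  refine ⟨G, ?_⟩
  have := congrArg (A0 𝒜).val hG
  exact this.symm.trans (aeval_algHom_apply (A0 𝒜).val w G).symm
end fix

set_option linter.unusedSectionVars false
section fixp
open DirectSum
variable {K M : Type*} [Field K] [IsAlgClosed K] [AddCommGroup M]
  [DecidableEq M] [IsAddTorsionFree M] [TwoUniqueSums M]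
  (𝒜 : M → Submodule K (MvPolynomial (Fin 2) K)) [GradedAlgebra 𝒜]

lemma gr_mul_mem {a b : MvPolynomial (Fin 2) K} {m n : M} (ha : a ∈ 𝒜 m) (hb : b ∈ 𝒜 n) :
    a * b ∈ 𝒜 (m + n) := SetLike.GradedMul.mul_mem (A := 𝒜) ha hb

lemma gr_pow_mem {a : MvPolynomial (Fin 2) K} {m : M} (ha : a ∈ 𝒜 m) (i : ℕ) :
    a ^ i ∈ 𝒜 (i • m) := SetLike.pow_mem_graded (A := 𝒜) i ha

lemma isUnit_C_iff {f : MvPolynomial (Fin 2) K} : IsUnit f ↔ ∃ c, c ≠ 0 ∧ f = MvPolynomial.C c := by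
  constructor
  · intro h
    obtain ⟨c, hc, h⟩ := MvPolynomial.isUnit_iff_eq_C_of_isReduced.1 h
    exact ⟨c, hc.ne_zero, h⟩
  · rintro ⟨c, hc, rfl⟩
    exact (IsUnit.mk0 c hc).map MvPolynomial.C

lemma unit_mem {f : MvPolynomial (Fin 2) K} (h : IsUnit f) : f ∈ 𝒜 0 := by
  obtain ⟨c, hc, rfl⟩ := isUnit_C_iff.1 h
  exact C_mem 𝒜 c

lemma prime_factor_mem {f P : MvPolynomial (Fin 2) K} {m : M} (hf : f ∈ 𝒜 m) (hf0 : f ≠ 0)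
    (hP : P ∣ f) : ∃ n, P ∈ 𝒜 n := by
  obtain ⟨k, rfl⟩ := hP
  obtain ⟨n, h, _⟩ := gr_factor 𝒜 hf0 hf
  exact ⟨n, h⟩

lemma exists_prime_hom (f : MvPolynomial (Fin 2) K) (hf0 : f ≠ 0) :
    ∀ m ≠ 0, f ∈ 𝒜 m → ∃ P n, Prime P ∧ P ∣ f ∧ P ∈ 𝒜 n ∧ n ≠ 0 := by
  induction f using UniqueFactorizationMonoid.induction_on_prime with
  | h₁ => exact absurd rfl hf0
  | h₂ x hx =>
    intro m hm h
    exact absurd (gr_deg_unique 𝒜 h (unit_mem 𝒜 hx) hf0) hm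
  | h₃ a p ha hp ih =>
    intro m hm h
    obtain ⟨n, h1, h2⟩ := gr_factor 𝒜 hf0 h
    by_cases hn : n = 0
    · subst hn
      rw [sub_zero] at h2
      obtain ⟨P, n, h3, h4, h5⟩ := ih ha m hm h2
      exact ⟨P, n, h3, h4.mul_left _, h5⟩
    · exact ⟨p, n, hp, dvd_mul_right _ _, h1, hn⟩

lemma one_mem_J (J : Submodule K (MvPolynomial (Fin 2) K))
    (hI : Ideal.span {f | ∃ m, m ≠ 0 ∧ f ∈ 𝒜 m} = ⊤)
    (h : ∀ m, m ≠ 0 → ∀ f ∈ 𝒜 m, ∀ g ∈ 𝒜 (-m), g * f ∈ J) : 1 ∈ J := by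
  have key : ∀ x ∈ Ideal.span {f | ∃ m, m ≠ 0 ∧ f ∈ 𝒜 m}, ∀ a, pr 𝒜 0 (a * x) ∈ J := by
    intro x hx
    induction hx using Submodule.span_induction with
    | mem x hx =>
      obtain ⟨m, hm, hx⟩ := hx
      intro a
      rw [pr_mul_right 𝒜 a hx]
      exact h m hm x hx _ (by rw [zero_sub]; exact pr_mem _ _ _)
    | zero => simp
    | add x y _ _ hx hy => intro a; rw [mul_add, map_add]; exact J.add_mem (hx a) (hy a)
    | smul b x _ hx => intro a; rw [smul_eq_mul, ← mul_assoc]; exact hx _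
  have := key 1 (by rw [hI]; trivial) 1
  rwa [mul_one, pr_same 𝒜 SetLike.GradedOne.one_mem] at this

open Polynomial in
lemma dvd_aeval_of {P w : MvPolynomial (Fin 2) K} {G : K[X]} (hP : Prime P) (hw : P ∣ w)
    (hG : P ∣ aeval w G) : w ∣ aeval w G := by
  have h1 : aeval w G = w * aeval w G.divX + MvPolynomial.C (G.coeff 0) := by
    conv_lhs => rw [← X_mul_divX_add G]
    rw [map_add, map_mul, aeval_X, aeval_C]; rfl
  have h2 : P ∣ MvPolynomial.C (G.coeff 0) := by
    rw [h1] at hG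
    exact (dvd_add_right (hw.mul_right _)).1 hG
  have h3 : G.coeff 0 = 0 := by
    by_contra h
    exact hP.not_isUnit (isUnit_of_dvd_unit h2 (isUnit_C_iff.2 ⟨_, h, rfl⟩))
  rw [h1, h3]; simp

open Polynomial in
lemma coprime_aeval_of {w : MvPolynomial (Fin 2) K} {G : K[X]} 
    (hG : ¬ w ∣ aeval w G) : IsCoprime w (aeval w G) := by
  have h1 : aeval w G = w * aeval w G.divX + MvPolynomial.C (G.coeff 0) := by
    conv_lhs => rw [← X_mul_divX_add G]
    rw [map_add, map_mul, aeval_X, aeval_C]; rfl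
  have h3 : G.coeff 0 ≠ 0 := by
    intro h
    apply hG
    rw [h1, h]; simp
  rw [h1]
  refine ⟨-(MvPolynomial.C (G.coeff 0)⁻¹ * aeval w G.divX), MvPolynomial.C (G.coeff 0)⁻¹, ?_⟩
  have : MvPolynomial.C (σ := Fin 2) (G.coeff 0)⁻¹ * MvPolynomial.C (G.coeff 0) = 1 := by
    rw [← map_mul, inv_mul_cancel₀ h3, map_one]
  linear_combination this

open Polynomial in
lemma final_contra {n k : M} {P w h x : MvPolynomial (Fin 2) K} (hP : Prime P) (hPn : P ∈ 𝒜 n)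
    (hn : n ≠ 0) (hwh : w = P * h) (hh : h ∈ 𝒜 (0 - n))
    (hgen : ∀ f ∈ 𝒜 0, ∃ G : K[X], f = aeval w G)
    (hx : x ∈ 𝒜 k) (hc : IsCoprime w x) (a b : ℕ) (ha : a ≠ 0) (hab : a • n + b • k = 0) : False := by
  have h1 : P ^ a * x ^ b ∈ 𝒜 0 := by
    rw [← hab]; exact gr_mul_mem 𝒜 (gr_pow_mem 𝒜 hPn a) (gr_pow_mem 𝒜 hx b)
  obtain ⟨G, hG⟩ := hgen _ h1
  have h2 : w ∣ P ^ a * x ^ b := by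
    rw [hG]
    apply dvd_aeval_of hP ⟨h, hwh⟩
    rw [← hG]
    exact (dvd_pow_self P ha).mul_right _
  have h3 : w ∣ P ^ a := (hc.pow_right).dvd_of_dvd_mul_right h2
  have h4 : h ∣ P ^ a := (Dvd.intro_left _ hwh.symm).trans h3
  obtain ⟨i, _, u, hu⟩ := (dvd_prime_pow hP _).1 h4
  have h5 : P ^ i ∈ 𝒜 (0 - n) := by
    rw [← hu]
    have := gr_mul_mem 𝒜 hh (unit_mem 𝒜 u.isUnit)
    rwa [add_zero] at this
  have h6 := gr_deg_unique 𝒜 h5 (gr_pow_mem 𝒜 hPn i) (pow_ne_zero _ hP.ne_zero)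
  have h7 : (i + 1) • n = 0 := by
    rw [add_smul, ← h6, one_smul]; simp
  exact hn ((smul_eq_zero.1 h7).resolve_left (by omega))

open Polynomial in
lemma span_ne_top : Ideal.span {f | ∃ m, m ≠ 0 ∧ f ∈ 𝒜 m} ≠ ⊤ := by
  intro hI
  obtain ⟨m, hm, f, hf, g, hg, hgf⟩ : ∃ m, m ≠ 0 ∧ ∃ f ∈ 𝒜 m, ∃ g ∈ 𝒜 (-m), g * f ≠ 0 := by
    by_contra! hcon
    exact one_ne_zero ((Submodule.mem_bot K).1
      (one_mem_J 𝒜 ⊥ hI fun m hm f hf g hg => (Submodule.mem_bot K).2 (hcon m hm f hf g hg)))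
  have hgf0 : g * f ∈ 𝒜 0 := by
    have := gr_mul_mem 𝒜 hg hf
    rwa [neg_add_cancel] at this
  have hf0 : f ≠ 0 := right_ne_zero_of_mul hgf
  have hnc : ∀ c, g * f ≠ MvPolynomial.C c := by
    intro c hc
    have hu : IsUnit (g * f) := isUnit_C_iff.2 ⟨c, by rintro rfl; simp [hgf] at hc, hc⟩
    exact hm (gr_deg_unique 𝒜 hf (unit_mem 𝒜 (isUnit_of_mul_isUnit_right hu)) hf0)
  obtain ⟨w0, hw0, hgen0⟩ := A0_gen 𝒜 hm hf hf0 hgf0 hnc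
  obtain ⟨P, n, hP, hPf, hPn, hn⟩ := exists_prime_hom 𝒜 f hf0 m hm hf
  obtain ⟨c, hc⟩ : ∃ c, P ∣ w0 - MvPolynomial.C c := by
    obtain ⟨G, hG⟩ := hgen0 _ hgf0
    have hpr : (Ideal.span {P}).IsPrime := (Ideal.span_singleton_prime hP.ne_zero).2 hP
    have : IsAlgebraic K (Ideal.Quotient.mkₐ K (Ideal.span {P}) w0) := by
      refine ⟨G, by rintro rfl; simp [hgf] at hG, ?_⟩
      rw [aeval_algHom_apply, ← hG, Ideal.Quotient.mkₐ_eq_mk, Ideal.Quotient.eq_zero_iff_mem,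
        Ideal.mem_span_singleton]
      exact hPf.mul_left _
    obtain ⟨c, hc⟩ := mem_range_of_algebraic this
    refine ⟨c, ?_⟩
    rw [← Ideal.mem_span_singleton, ← Ideal.Quotient.eq_zero_iff_mem, map_sub]
    exact sub_eq_zero.2 hc.symm
  obtain ⟨w, hwdef⟩ : ∃ w, w = w0 - MvPolynomial.C c := ⟨_, rfl⟩
  rw [← hwdef] at hc
  have hgen : ∀ f ∈ 𝒜 0, ∃ G : K[X], f = aeval w G := by
    intro f hf
    obtain ⟨G, rfl⟩ := hgen0 f hf
    refine ⟨G.comp (X + C c), ?_⟩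
    rw [aeval_comp]
    congr 1
    rw [hwdef]; simp [← MvPolynomial.algebraMap_eq]
  have hw : w ∈ 𝒜 0 := by rw [hwdef]; exact (𝒜 0).sub_mem hw0 (C_mem 𝒜 c)
  have hwne : w ≠ 0 := by
    rintro rfl
    obtain ⟨G, hG⟩ := hgen _ hgf0
    rw [← X_mul_divX_add G, map_add, map_mul, aeval_X, aeval_C, zero_mul, zero_add] at hG
    exact hnc _ hG
  obtain ⟨h, hh⟩ := hc
  have hhn : h ∈ 𝒜 (0 - n) := gr_sub_mem 𝒜 hPn hP.ne_zero (by rw [← hh]; exact hw)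
  obtain ⟨m2, hm2, f2, hf2, g2, hg2, hgf2⟩ : ∃ m, m ≠ 0 ∧ ∃ f ∈ 𝒜 m, ∃ g ∈ 𝒜 (-m), ¬ w ∣ g * f := by
    by_contra! hcon
    have := one_mem_J 𝒜 ((Ideal.span {w}).restrictScalars K) hI
      fun m hm f hf g hg => Ideal.mem_span_singleton.2 (hcon m hm f hf g hg)
    have := Ideal.mem_span_singleton.1 this
    exact hP.not_isUnit (isUnit_of_dvd_one ((Dvd.intro _ hh.symm).trans this))
  have hgf20 : g2 * f2 ∈ 𝒜 0 := by
    have := gr_mul_mem 𝒜 hg2 hf2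
    rwa [neg_add_cancel] at this
  have hcop : IsCoprime w (g2 * f2) := by
    obtain ⟨G, hG⟩ := hgen _ hgf20
    rw [hG] at hgf2 ⊢
    exact coprime_aeval_of hgf2
  obtain ⟨hcg, hcf⟩ := IsCoprime.mul_right_iff.1 hcop
  obtain ⟨a, b, hb, hab⟩ := dep_weights 𝒜 hPn hP.ne_zero hgf0 hnc hf2
    (by rintro rfl; simp at hgf2) hn
  have ha : a ≠ 0 := by
    rintro rfl
    rw [zero_smul, zero_add] at hab
    exact hm2 ((smul_eq_zero.1 hab).resolve_left hb)
  have ha' : a.natAbs ≠ 0 := by omega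
  have e1 : a.natAbs • n + b.natAbs • m2 = 0 ∨ a.natAbs • n + b.natAbs • (-m2) = 0 := by
    rcases Int.natAbs_eq a with h1 | h1 <;> rcases Int.natAbs_eq b with h2 | h2 <;>
      rw [h1, h2] at hab
    · left; simpa only [natCast_zsmul] using hab
    · right; simpa only [natCast_zsmul, neg_smul, smul_neg] using hab
    · right
      rw [← neg_eq_zero]
      simp only [neg_smul, natCast_zsmul] at hab
      rw [← hab]; simp; abel
    · left
      rw [← neg_eq_zero]
      simp only [neg_smul, natCast_zsmul] at hab
      rw [← hab]; abel
  rcases e1 with e1 | e1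
  · exact final_contra 𝒜 hP hPn hn hh hhn hgen hf2 hcf _ _ ha' e1
  · exact final_contra 𝒜 hP hPn hn hh hhn hgen hg2 hcg _ _ ha' e1

lemma exists_fixed : ∃ p : Fin 2 → K, ∀ m ≠ 0, ∀ f ∈ 𝒜 m, MvPolynomial.eval p f = 0 := by
  obtain ⟨I, hI, hle⟩ := Ideal.exists_le_maximal _ (span_ne_top 𝒜)
  obtain ⟨p, hp⟩ := (MvPolynomial.isMaximal_iff_eq_vanishingIdeal_singleton (I := I)).1 hI
  refine ⟨p, fun m hm f hf => ?_⟩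
  have : f ∈ I := hle (Ideal.subset_span ⟨m, hm, hf⟩)
  rw [hp, MvPolynomial.mem_vanishingIdeal_singleton_iff] at this
  exact this
end fixp

set_option linter.unusedSectionVars false
section lin
open DirectSum MvPolynomial
variable {K M : Type*} [Field K] [IsAlgClosed K] [AddCommGroup M]
  [DecidableEq M] [IsAddTorsionFree M] [TwoUniqueSums M]
  (𝒜 : M → Submodule K (MvPolynomial (Fin 2) K)) [GradedAlgebra 𝒜]

/-- maximal ideal of the point `p`. -/
noncomputable def mI (p : Fin 2 → K) : Ideal (MvPolynomial (Fin 2) K) := RingHom.ker (eval p)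

lemma mem_mI {p : Fin 2 → K} {f : MvPolynomial (Fin 2) K} : f ∈ mI p ↔ eval p f = 0 := Iff.rfl

lemma mI_ne_top (p : Fin 2 → K) : mI p ≠ ⊤ := by
  intro h
  have : (1 : MvPolynomial (Fin 2) K) ∈ mI p := by rw [h]; trivial
  rw [mem_mI] at this
  simp at this

/-- linear part at `p`. -/
noncomputable def linP (p : Fin 2 → K) : MvPolynomial (Fin 2) K →ₗ[K] (Fin 2 → K) :=
  LinearMap.pi fun i => (aeval p).toLinearMap ∘ₗ (pderiv i).toLinearMap

lemma linP_apply (p : Fin 2 → K) (f) (i) : linP p f i = eval p (pderiv i f) := by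
  simp [linP, aeval_eq_eval]

lemma linP_mul (p : Fin 2 → K) (f g) : linP p (f * g) = eval p f • linP p g + eval p g • linP p f := by
  ext i
  simp [linP_apply, Derivation.leibniz]

lemma taylor (p : Fin 2 → K) (f : MvPolynomial (Fin 2) K) :
    f - C (eval p f) - ∑ i, C (linP p f i) * (X i - C (p i)) ∈ mI p ^ 2 := by
  induction f using MvPolynomial.induction_on with
  | C a => simp [linP_apply]
  | add f g hf hg =>
    convert Ideal.add_mem _ hf hg using 1
    simp [Fin.sum_univ_two]; ring
  | mul_X f i hf =>
    have hX : (X i - C (p i) : MvPolynomial (Fin 2) K) ∈ mI p := by rw [mem_mI]; simp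
    have hfm : f - C (eval p f) ∈ mI p := by rw [mem_mI]; simp
    have h1 : (f - C (eval p f)) * (X i - C (p i)) ∈ mI p ^ 2 := by
      rw [pow_two]; exact Ideal.mul_mem_mul hfm hX
    have h2 := Ideal.mul_mem_left _ (C (p i)) hf
    convert Ideal.add_mem _ h1 h2 using 1
    rw [linP_mul]
    have : ∀ j, linP p (X i) j = if j = i then 1 else 0 := by
      intro j
      rw [linP_apply, pderiv_X]
      simp [Pi.single_apply, apply_ite, eq_comm]
    simp only [Pi.add_apply, Pi.smul_apply, this, Fin.sum_univ_two, smul_eq_mul, map_add, map_mul,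
      eval_X]
    fin_cases i <;> simp <;> ring


lemma eval_pr_zero {p : Fin 2 → K} (hp : ∀ m ≠ 0, ∀ f ∈ 𝒜 m, eval p f = 0)
    (f : MvPolynomial (Fin 2) K) : eval p (pr 𝒜 0 f) = eval p f := by
  obtain ⟨S, hS, hs⟩ := pr_sum 𝒜 f
  conv_rhs => rw [← hs, map_sum]
  rw [Finset.sum_eq_single 0]
  · intro b _ hb
    exact hp b hb _ (pr_mem _ _ _)
  · intro h
    rw [hS, not_not] at h
    rw [h, map_zero]

lemma mI_hom {p : Fin 2 → K} (hp : ∀ m ≠ 0, ∀ f ∈ 𝒜 m, eval p f = 0)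
    {f : MvPolynomial (Fin 2) K} (hf : f ∈ mI p) (k : M) : pr 𝒜 k f ∈ mI p := by
  rw [mem_mI] at *
  by_cases hk : k = 0
  · subst hk
    rw [eval_pr_zero 𝒜 hp, hf]
  · exact hp k hk _ (pr_mem _ _ _)

lemma mI_pow_hom {p : Fin 2 → K} (hp : ∀ m ≠ 0, ∀ f ∈ 𝒜 m, eval p f = 0) (N : ℕ) :
    ∀ f ∈ mI p ^ N, ∀ k, pr 𝒜 k f ∈ mI p ^ N := by
  induction N with
  | zero => intro f _ k; simp
  | succ N ih =>
    intro f hf k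
    rw [pow_succ] at *
    induction hf using Submodule.mul_induction_on' with
    | mem_mul_mem a ha b hb =>
      obtain ⟨S, hS, hs⟩ := pr_sum 𝒜 b
      rw [← hs, Finset.mul_sum, map_sum]
      refine Ideal.sum_mem _ fun j _ => ?_
      rw [pr_mul_right 𝒜 _ (pr_mem 𝒜 _ _)]
      exact Ideal.mul_mem_mul (ih a ha _) (mI_hom 𝒜 hp hb _)
    | add x _ y _ hx hy => rw [map_add]; exact Ideal.add_mem _ hx hy

lemma linP_mem_span {p : Fin 2 → K} (f : MvPolynomial (Fin 2) K) :
    ∀ m, f ∈ 𝒜 m → f ∈ mI p →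
    linP p f ∈ Submodule.span K {x | ∃ q n, Prime q ∧ q ∈ 𝒜 n ∧ q ∈ mI p ∧ linP p q = x} := by
  induction f using UniqueFactorizationMonoid.induction_on_prime with
  | h₁ => intros; rw [map_zero]; exact Submodule.zero_mem _
  | h₂ x hx =>
    intro m hm h
    exact absurd (Ideal.eq_top_of_isUnit_mem _ h hx) (mI_ne_top p)
  | h₃ a q ha hq ih =>
    intro m hm h
    obtain ⟨n, h1, h2⟩ := gr_factor 𝒜 (mul_ne_zero hq.ne_zero ha) hm
    rw [linP_mul]
    by_cases hqp : eval p q = 0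
    · rw [hqp, zero_smul, zero_add]
      exact Submodule.smul_mem _ _ (Submodule.subset_span ⟨q, n, hq, h1, hqp, rfl⟩)
    · have hap : eval p a = 0 := by
        rw [mem_mI, map_mul] at h
        exact (mul_eq_zero.1 h).resolve_left hqp
      rw [hap, zero_smul, add_zero]
      exact Submodule.smul_mem _ _ (ih _ h2 hap)

lemma exists_uv {p : Fin 2 → K} (hp : ∀ m ≠ 0, ∀ f ∈ 𝒜 m, eval p f = 0) :
    ∃ u v α β, Prime u ∧ Prime v ∧ u ∈ 𝒜 α ∧ v ∈ 𝒜 β ∧ u ∈ mI p ∧ v ∈ mI p ∧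
      ∀ f ∈ mI p, ∃ a b : K, f - (a • u + b • v) ∈ mI p ^ 2 := by
  set T : Set (Fin 2 → K) := {x | ∃ q n, Prime q ∧ q ∈ 𝒜 n ∧ q ∈ mI p ∧ linP p q = x} with hT
  have h1 : ∀ f ∈ mI p, linP p f ∈ Submodule.span K T := by
    intro f hf
    obtain ⟨S, hS, hs⟩ := pr_sum 𝒜 f
    rw [← hs, map_sum]
    exact Submodule.sum_mem _ fun k _ =>
      linP_mem_span 𝒜 _ k (pr_mem _ _ _) (mI_hom 𝒜 hp hf k)
  have htop : Submodule.span K T = ⊤ := by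
    rw [eq_top_iff]
    intro x _
    have : linP p (∑ i, C (x i) * (X i - C (p i))) = x := by
      ext j
      rw [linP_apply]
      fin_cases j <;> simp [Fin.sum_univ_two, pderiv_X, Derivation.leibniz, Pi.single_apply]
    rw [← this]
    apply h1
    rw [mem_mI]; simp
  obtain ⟨s, hsT, hs0⟩ : ∃ s ∈ T, s ≠ 0 := by
    by_contra! h
    have : Submodule.span K T = ⊥ := Submodule.span_eq_bot.2 h
    rw [htop] at this
    exact top_ne_bot this
  obtain ⟨s', hsT', hs'⟩ : ∃ s' ∈ T, s' ∉ Submodule.span K {s} := by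
    by_contra! h
    have h2 : Submodule.span K T ≤ Submodule.span K {s} := Submodule.span_le.2 h
    rw [htop, top_le_iff] at h2
    have h3 := finrank_span_singleton (K := K) hs0
    rw [h2, finrank_top] at h3
    simp at h3
  have hli : LinearIndependent K ![s, s'] := by
    rw [LinearIndependent.pair_iff' hs0]
    intro a ha
    exact hs' (Submodule.mem_span_singleton.2 ⟨a, ha⟩)
  have hspan := hli.span_eq_top_of_card_eq_finrank (by simp)
  obtain ⟨u, α, hu, huα, hup, rfl⟩ := hsT
  obtain ⟨v, β, hv, hvβ, hvp, rfl⟩ := hsT'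
  refine ⟨u, v, α, β, hu, hv, huα, hvβ, hup, hvp, fun f hf => ?_⟩
  have : linP p f ∈ Submodule.span K (Set.range ![linP p u, linP p v]) := by rw [hspan]; trivial
  rw [Matrix.range_cons, Matrix.range_cons, Matrix.range_empty, Set.union_empty,
    Set.singleton_union, Submodule.mem_span_pair] at this
  obtain ⟨a, b, hab⟩ := this
  refine ⟨a, b, ?_⟩
  have ht := taylor p (f - (a • u + b • v))
  have e1 : linP p (f - (a • u + b • v)) = 0 := by
    rw [map_sub, map_add, map_smul, map_smul, hab, sub_self]
  have e2 : eval p (f - (a • u + b • v)) = 0 := by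
    rw [mem_mI] at hf hup hvp
    simp [hf, hup, hvp, smul_eval]
  rw [e1, e2] at ht
  simpa using ht
end lin

set_option linter.unusedSectionVars false
section lin2
open DirectSum MvPolynomial
variable {K M : Type*} [Field K] [IsAlgClosed K] [AddCommGroup M]
  [DecidableEq M] [IsAddTorsionFree M] [TwoUniqueSums M]
  (𝒜 : M → Submodule K (MvPolynomial (Fin 2) K)) [GradedAlgebra 𝒜]

/-- span of monomials of degree at least `N` and weight `m`. -/
noncomputable def Vs (u v : MvPolynomial (Fin 2) K) (α β : M) (N : ℕ) (m : M) :
    Submodule K (MvPolynomial (Fin 2) K) :=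
  Submodule.span K {x | ∃ i j : ℕ, N ≤ i + j ∧ i • α + j • β = m ∧ x = u ^ i * v ^ j}

lemma Vs_le {u v : MvPolynomial (Fin 2) K} {α β : M} (hu : u ∈ 𝒜 α) (hv : v ∈ 𝒜 β)
    (N : ℕ) (m : M) : Vs u v α β N m ≤ 𝒜 m := by
  refine Submodule.span_le.2 ?_
  rintro _ ⟨i, j, _, rfl, rfl⟩
  exact gr_mul_mem 𝒜 (gr_pow_mem 𝒜 hu i) (gr_pow_mem 𝒜 hv j)

lemma Vs_anti {u v : MvPolynomial (Fin 2) K} {α β : M} {N N' : ℕ} (h : N ≤ N') (m : M) :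
    Vs u v α β N' m ≤ Vs u v α β N m := by
  refine Submodule.span_mono ?_
  rintro _ ⟨i, j, h1, h2, rfl⟩
  exact ⟨i, j, h.trans h1, h2, rfl⟩

lemma one_step {p : Fin 2 → K} {u v : MvPolynomial (Fin 2) K} (hup : u ∈ mI p) (hvp : v ∈ mI p)
    (huv : ∀ f ∈ mI p, ∃ a b : K, f - (a • u + b • v) ∈ mI p ^ 2) (N : ℕ) :
    ∀ f ∈ mI p ^ N, ∃ q ∈ Submodule.span K {x | ∃ i j : ℕ, i + j = N ∧ x = u ^ i * v ^ j},
      f - q ∈ mI p ^ (N + 1) := by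
  have hW : ∀ N, Submodule.span K {x | ∃ i j : ℕ, i + j = N ∧ x = u ^ i * v ^ j} ≤
      (mI p ^ N).restrictScalars K := by
    intro N
    refine Submodule.span_le.2 ?_
    rintro _ ⟨i, j, rfl, rfl⟩
    change u ^ i * v ^ j ∈ mI p ^ (i + j)
    rw [pow_add]
    exact Ideal.mul_mem_mul (Ideal.pow_mem_pow hup i) (Ideal.pow_mem_pow hvp j)
  induction N with
  | zero =>
    intro f _
    refine ⟨(eval p f) • 1, Submodule.smul_mem _ _ (Submodule.subset_span ⟨0, 0, rfl, by simp⟩), ?_⟩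
    rw [zero_add, pow_one, mem_mI]
    simp [smul_eval]
  | succ N ih =>
    intro f hf
    rw [pow_succ] at hf
    induction hf using Submodule.mul_induction_on' with
    | mem_mul_mem a ha b hb =>
      obtain ⟨q, hq, haq⟩ := ih a ha
      obtain ⟨c, d, hcd⟩ := huv b hb
      refine ⟨q * (c • u + d • v), ?_, ?_⟩
      · clear haq
        induction hq using Submodule.span_induction with
        | mem x hx =>
          obtain ⟨i, j, hij, rfl⟩ := hx
          have : u ^ i * v ^ j * (c • u + d • v) =
            c • (u ^ (i + 1) * v ^ j) + d • (u ^ i * v ^ (j + 1)) := by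
            simp only [smul_eq_C_mul]; ring
          rw [this]
          exact Submodule.add_mem _
            (Submodule.smul_mem _ _ (Submodule.subset_span ⟨i + 1, j, by omega, rfl⟩))
            (Submodule.smul_mem _ _ (Submodule.subset_span ⟨i, j + 1, by omega, rfl⟩))
        | zero => rw [zero_mul]; exact Submodule.zero_mem _
        | add x y _ _ hx hy => rw [add_mul]; exact Submodule.add_mem _ hx hy
        | smul a x _ hx => rw [smul_mul_assoc]; exact Submodule.smul_mem _ _ hx
      · have : a * b - q * (c • u + d • v) = (a - q) * b + q * (b - (c • u + d • v)) := by ring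
        rw [this]
        refine Ideal.add_mem _ ?_ ?_
        · rw [pow_succ]; exact Ideal.mul_mem_mul haq hb
        · rw [show N + 1 + 1 = N + 2 from rfl, pow_add]
          exact Ideal.mul_mem_mul (hW N hq) hcd
    | add x _ y _ hx hy =>
      obtain ⟨q, hq, h1⟩ := hx
      obtain ⟨q', hq', h2⟩ := hy
      refine ⟨q + q', Submodule.add_mem _ hq hq', ?_⟩
      rw [add_sub_add_comm]
      exact Ideal.add_mem _ h1 h2

lemma hom_step {p : Fin 2 → K} (hp : ∀ m ≠ 0, ∀ f ∈ 𝒜 m, eval p f = 0)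
    {u v : MvPolynomial (Fin 2) K} {α β : M} (hu : u ∈ 𝒜 α) (hv : v ∈ 𝒜 β)
    (hup : u ∈ mI p) (hvp : v ∈ mI p)
    (huv : ∀ f ∈ mI p, ∃ a b : K, f - (a • u + b • v) ∈ mI p ^ 2) (N : ℕ) (m : M)
    {f : MvPolynomial (Fin 2) K} (hf : f ∈ mI p ^ N) (hfm : f ∈ 𝒜 m) :
    ∃ q ∈ Vs u v α β N m, f - q ∈ mI p ^ (N + 1) := by
  obtain ⟨q, hq, hfq⟩ := one_step hup hvp huv N f hf
  refine ⟨pr 𝒜 m q, ?_, ?_⟩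
  · clear hfq
    induction hq using Submodule.span_induction with
    | mem x hx =>
      obtain ⟨i, j, hij, rfl⟩ := hx
      have hw : u ^ i * v ^ j ∈ 𝒜 (i • α + j • β) :=
        gr_mul_mem 𝒜 (gr_pow_mem 𝒜 hu i) (gr_pow_mem 𝒜 hv j)
      by_cases h : i • α + j • β = m
      · rw [h] at hw
        rw [pr_same 𝒜 hw]
        exact Submodule.subset_span ⟨i, j, hij.ge, h, rfl⟩
      · rw [pr_ne 𝒜 hw h]; exact Submodule.zero_mem _
    | zero => rw [map_zero]; exact Submodule.zero_mem _
    | add x y _ _ hx hy => rw [map_add]; exact Submodule.add_mem _ hx hy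
    | smul a x _ hx => rw [map_smul]; exact Submodule.smul_mem _ _ hx
  · have := mI_pow_hom 𝒜 hp _ _ hfq m
    rwa [map_sub, pr_same 𝒜 hfm] at this

lemma hom_iter {p : Fin 2 → K} (hp : ∀ m ≠ 0, ∀ f ∈ 𝒜 m, eval p f = 0)
    {u v : MvPolynomial (Fin 2) K} {α β : M} (hu : u ∈ 𝒜 α) (hv : v ∈ 𝒜 β)
    (hup : u ∈ mI p) (hvp : v ∈ mI p)
    (huv : ∀ f ∈ mI p, ∃ a b : K, f - (a • u + b • v) ∈ mI p ^ 2) (N : ℕ) (m : M)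
    {f : MvPolynomial (Fin 2) K} (hf : f ∈ mI p ^ N) (hfm : f ∈ 𝒜 m) (k : ℕ) :
    ∃ q ∈ Vs u v α β N m, f - q ∈ mI p ^ (N + k) := by
  induction k with
  | zero => exact ⟨0, Submodule.zero_mem _, by simpa using hf⟩
  | succ k ih =>
    obtain ⟨q, hq, h⟩ := ih
    obtain ⟨q', hq', h'⟩ := hom_step 𝒜 hp hu hv hup hvp huv (N + k) m h
      ((𝒜 m).sub_mem hfm (Vs_le 𝒜 hu hv _ _ hq))
    refine ⟨q + q', Submodule.add_mem _ hq (Vs_anti (by omega) _ hq'), ?_⟩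
    rw [← sub_sub]; exact h'

lemma krull_zero {p : Fin 2 → K} {f : MvPolynomial (Fin 2) K} (h : ∀ k, f ∈ mI p ^ k) : f = 0 := by
  have := Ideal.iInf_pow_eq_bot_of_isDomain (mI p) (mI_ne_top p)
  rw [← Ideal.mem_bot, ← this, Submodule.mem_iInf]
  exact h

lemma krull_dvd {p : Fin 2 → K} {f u : MvPolynomial (Fin 2) K} (hu : Prime u) (hup : u ∈ mI p)
    (h : ∀ k, ∃ q, u ∣ q ∧ f - q ∈ mI p ^ k) : u ∣ f := by
  have hpr : (Ideal.span {u}).IsPrime := (Ideal.span_singleton_prime hu.ne_zero).2 hu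
  let φ := Ideal.Quotient.mk (Ideal.span {u})
  have hker : RingHom.ker φ ≤ mI p := by
    rw [Ideal.mk_ker, Ideal.span_singleton_le_iff_mem]; exact hup
  have hne : (mI p).map φ ≠ ⊤ := by
    intro htop
    have := Ideal.comap_map_of_surjective φ Ideal.Quotient.mk_surjective (mI p)
    rw [htop, Ideal.comap_top] at this
    apply mI_ne_top p
    rw [this]
    exact sup_eq_left.2 hker |>.symm
  have hb := Ideal.iInf_pow_eq_bot_of_isDomain _ hne
  rw [← Ideal.mem_span_singleton, ← Ideal.Quotient.eq_zero_iff_mem, ← Ideal.mem_bot, ← hb,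
    Submodule.mem_iInf]
  intro k
  obtain ⟨q, hq, hfq⟩ := h k
  have h1 : φ (f - q) ∈ (mI p ^ k).map φ := Ideal.mem_map_of_mem _ hfq
  have h2 : φ q = 0 := Ideal.Quotient.eq_zero_iff_mem.2 (Ideal.mem_span_singleton.2 hq)
  rw [map_sub, h2, sub_zero, Ideal.map_pow] at h1
  exact h1

lemma mem_Vs_of_finite {p : Fin 2 → K} (hp : ∀ m ≠ 0, ∀ f ∈ 𝒜 m, eval p f = 0)
    {u v : MvPolynomial (Fin 2) K} {α β : M} (hu : u ∈ 𝒜 α) (hv : v ∈ 𝒜 β)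
    (hup : u ∈ mI p) (hvp : v ∈ mI p)
    (huv : ∀ f ∈ mI p, ∃ a b : K, f - (a • u + b • v) ∈ mI p ^ 2) (m : M)
    (hfin : {x : ℕ × ℕ | x.1 • α + x.2 • β = m}.Finite)
    {f : MvPolynomial (Fin 2) K} (hfm : f ∈ 𝒜 m) : f ∈ Vs u v α β 0 m := by
  obtain ⟨B, hB⟩ : ∃ B, ∀ i j : ℕ, i • α + j • β = m → i + j < B := by
    obtain ⟨B, hB⟩ := (hfin.image fun x => x.1 + x.2).bddAbove
    refine ⟨B + 1, fun i j h => Nat.lt_succ_of_le (hB ⟨(i, j), h, rfl⟩)⟩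
  obtain ⟨q, hq, hfq⟩ := hom_iter 𝒜 hp hu hv hup hvp huv 0 m (f := f) (by simp) hfm B
  rw [zero_add] at hfq
  have : f - q = 0 := by
    have hm' : f - q ∈ 𝒜 m := (𝒜 m).sub_mem hfm (Vs_le 𝒜 hu hv _ _ hq)
    apply krull_zero (p := p)
    intro k
    obtain ⟨q', hq', h'⟩ := hom_iter 𝒜 hp hu hv hup hvp huv B m hfq hm' k
    have hV : Vs u v α β B m = ⊥ := by
      refine Submodule.span_eq_bot.2 ?_
      rintro _ ⟨i, j, h1, h2, rfl⟩
      have := hB i j h2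
      omega
    rw [hV, Submodule.mem_bot] at hq'
    rw [hq', sub_zero] at h'
    exact Ideal.pow_le_pow_right (by omega) h'
  rw [sub_eq_zero.1 this]; exact hq

lemma Vs_le_adjoin {u v : MvPolynomial (Fin 2) K} {α β : M} {N m} {f}
    (hf : f ∈ Vs u v α β N m) : f ∈ Algebra.adjoin K {u, v} := by
  suffices h : Vs u v α β N m ≤ Subalgebra.toSubmodule (Algebra.adjoin K {u, v}) from h hf
  refine Submodule.span_le.2 ?_
  rintro _ ⟨i, j, h1, h2, rfl⟩
  exact Subalgebra.mul_mem _ (Subalgebra.pow_mem _ (Algebra.subset_adjoin (by simp)) _)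
    (Subalgebra.pow_mem _ (Algebra.subset_adjoin (by simp)) _)

lemma dvd_case {p : Fin 2 → K} (hp : ∀ m ≠ 0, ∀ f ∈ 𝒜 m, eval p f = 0)
    {u v : MvPolynomial (Fin 2) K} {α β : M} (hu : u ∈ 𝒜 α) (hv : v ∈ 𝒜 β)
    (hup : u ∈ mI p) (hvp : v ∈ mI p) {z} (hz : Prime z) (hzp : z ∈ mI p)
    (huv : ∀ f ∈ mI p, ∃ a b : K, f - (a • u + b • v) ∈ mI p ^ 2) (m : M)
    (hS : ∀ i j : ℕ, 1 ≤ i + j → i • α + j • β = m → z ∣ u ^ i * v ^ j)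
    {f : MvPolynomial (Fin 2) K} (hfm : f ∈ 𝒜 m) (hfp : f ∈ mI p) : z ∣ f := by
  apply krull_dvd hz hzp
  intro k
  obtain ⟨q, hq, h⟩ := hom_iter 𝒜 hp hu hv hup hvp huv 1 m (f := f) (by simpa using hfp) hfm k
  refine ⟨q, ?_, Ideal.pow_le_pow_right (by omega) h⟩
  have : Vs u v α β 1 m ≤ (Ideal.span {z}).restrictScalars K := by
    refine Submodule.span_le.2 ?_
    rintro _ ⟨i, j, h1, h2, rfl⟩
    exact Ideal.mem_span_singleton.2 (hS i j h1 h2)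
  exact Ideal.mem_span_singleton.1 (this hq)

theorem graded_plane : ∃ u v α β, u ∈ 𝒜 α ∧ v ∈ 𝒜 β ∧ Algebra.adjoin K {u, v} = ⊤ := by
  obtain ⟨p, hp⟩ := exists_fixed 𝒜
  obtain ⟨u, v, α, β, hu, hv, huα, hvβ, hup, hvp, huv⟩ := exists_uv 𝒜 hp
  by_cases h0 : α = 0 ∧ β = 0
  · obtain ⟨rfl, rfl⟩ := h0
    have hz : ∀ m ≠ 0, ∀ f ∈ 𝒜 m, f = 0 := by
      intro m hm f hf
      have h1 := mem_Vs_of_finite 𝒜 hp huα hvβ hup hvp huv m (by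
        convert Set.finite_empty (α := ℕ × ℕ)
        ext x; simp [Ne.symm hm]) hf
      have hV : Vs u v (0 : M) 0 0 m = ⊥ := by
        refine Submodule.span_eq_bot.2 ?_
        rintro _ ⟨i, j, h1, h2, rfl⟩
        simp [Ne.symm hm] at h2
      rwa [hV, Submodule.mem_bot] at h1
    have hall : ∀ f, f ∈ 𝒜 0 := fun f => mem_of_pr 𝒜 fun k hk => hz k hk _ (pr_mem _ _ _)
    refine ⟨X 0, X 1, 0, 0, hall _, hall _, ?_⟩
    rw [← MvPolynomial.adjoin_range_X]
    congr 1
    ext x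
    constructor
    · rintro (rfl | rfl) <;> exact ⟨_, rfl⟩
    · rintro ⟨i, rfl⟩
      fin_cases i <;> simp
  · refine ⟨u, v, α, β, huα, hvβ, ?_⟩
    suffices hmain : ∀ m, ∀ f ∈ 𝒜 m, f ∈ Algebra.adjoin K {u, v} by
      rw [eq_top_iff]
      intro f _
      obtain ⟨S, hS, hs⟩ := pr_sum 𝒜 f
      rw [← hs]
      exact Subalgebra.sum_mem _ fun k _ => hmain k _ (pr_mem _ _ _)
    by_cases hrel : ∃ i j : ℕ, (i ≠ 0 ∨ j ≠ 0) ∧ i • α + j • β = 0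
    · obtain ⟨i0, j0, hij0, hrel⟩ := hrel
      have hdich : ∀ m, ∃ z, (z = u ∨ z = v) ∧
          ∀ i j : ℕ, 1 ≤ i + j → i • α + j • β = m → z ∣ u ^ i * v ^ j := by
        intro m
        by_contra! hcon
        obtain ⟨i, j, hij, hm, hnd⟩ := hcon u (Or.inl rfl)
        obtain ⟨i', j', hij', hm', hnd'⟩ := hcon v (Or.inr rfl)
        have hi : i = 0 := by
          by_contra h
          exact hnd ((dvd_pow_self u h).mul_right _)
        have hj' : j' = 0 := by
          by_contra h
          exact hnd' ((dvd_pow_self v h).mul_left _)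
        subst hi hj'
        rw [zero_smul, zero_add] at hm
        rw [zero_smul, add_zero] at hm'
        have hβ : (i0 * j + j0 * i') • β = 0 := by
          have h1 : i' • (i0 • α + j0 • β) = 0 := by rw [hrel, smul_zero]
          rw [smul_add, smul_comm i' i0 α, hm', ← hm, smul_smul, smul_smul, ← add_smul] at h1
          rw [← h1, mul_comm j0]
        have hpos : i0 * j + j0 * i' ≠ 0 := by
          have hj1 : j ≠ 0 := by omega
          have hi1 : i' ≠ 0 := by omega
          rcases hij0 with h | h
          · have := mul_ne_zero h hj1; omega
          · have := mul_ne_zero h hi1; omega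
        have hβ0 : β = 0 := (smul_eq_zero.1 hβ).resolve_left hpos
        rw [hβ0, smul_zero] at hm
        rw [← hm] at hm'
        exact h0 ⟨(smul_eq_zero.1 hm').resolve_left (by omega), hβ0⟩
      suffices hind : ∀ d : ℕ, ∀ m, ∀ f ∈ 𝒜 m, f.totalDegree = d →
          f ∈ Algebra.adjoin K {u, v} from fun m f hf => hind _ m f hf rfl
      intro d
      induction d using Nat.strong_induction_on with
      | _ d ih =>
      intro m f hf hd
      have hf0m : f - C (eval p f) ∈ 𝒜 m := by
        by_cases hm : m = 0
        · subst hm; exact (𝒜 0).sub_mem hf (C_mem 𝒜 _)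
        · rw [hp m hm f hf, map_zero, sub_zero]; exact hf
      have hf0p : f - C (eval p f) ∈ mI p := by rw [mem_mI]; simp
      have hdeg : (f - C (eval p f)).totalDegree ≤ d := hd ▸ totalDegree_sub_C_le _ _
      suffices hh : f - C (eval p f) ∈ Algebra.adjoin K {u, v} by
        have := Subalgebra.add_mem _ hh (Subalgebra.algebraMap_mem _ (eval p f))
        rwa [algebraMap_eq, sub_add_cancel] at this
      by_cases hne : f - C (eval p f) = 0
      · rw [hne]; exact Subalgebra.zero_mem _
      obtain ⟨z, hz, hzd⟩ := hdich m
      have hzz : Prime z ∧ z ∈ mI p ∧ (∃ γ, z ∈ 𝒜 γ) ∧ z ∈ Algebra.adjoin K {u, v} := by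
        rcases hz with rfl | rfl
        · exact ⟨hu, hup, ⟨_, huα⟩, Algebra.subset_adjoin (by simp)⟩
        · exact ⟨hv, hvp, ⟨_, hvβ⟩, Algebra.subset_adjoin (by simp)⟩
      obtain ⟨hzp, hzm, ⟨γ, hγ⟩, hza⟩ := hzz
      obtain ⟨f', hf'⟩ := dvd_case 𝒜 hp huα hvβ hup hvp hzp hzm huv m hzd hf0m hf0p
      have hf'0 : f' ≠ 0 := by rintro rfl; rw [mul_zero] at hf'; exact hne hf'
      have hf'm : f' ∈ 𝒜 (m - γ) := gr_sub_mem 𝒜 hγ hzp.ne_zero (by rw [← hf']; exact hf0m)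
      rw [hf']
      refine Subalgebra.mul_mem _ hza (ih f'.totalDegree ?_ _ f' hf'm rfl)
      rw [hf', totalDegree_mul_of_isDomain hzp.ne_zero hf'0] at hdeg
      have : z.totalDegree ≠ 0 := by
        intro h
        rw [totalDegree_eq_zero_iff_eq_C] at h
        refine hzp.not_isUnit (isUnit_C_iff.2 ⟨_, ?_, h⟩)
        intro hc
        rw [hc, map_zero] at h
        exact hzp.ne_zero h
      omega
    · push Not at hrel
      intro m f hf
      refine Vs_le_adjoin (mem_Vs_of_finite 𝒜 hp huα hvβ hup hvp huv m ?_ hf)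
      apply WellQuasiOrderedLE.finite_of_isAntichain
      intro x hx y hy hxy hle
      apply hxy
      have h1 : x.1 ≤ y.1 := hle.1
      have h2 : x.2 ≤ y.2 := hle.2
      have h3 : (y.1 - x.1) • α + (y.2 - x.2) • β = 0 := by
        have e1 : y.1 • α = (y.1 - x.1) • α + x.1 • α := by rw [← add_smul, Nat.sub_add_cancel h1]
        have e2 : y.2 • β = (y.2 - x.2) • β + x.2 • β := by rw [← add_smul, Nat.sub_add_cancel h2]
        have hy' : y.1 • α + y.2 • β = m := hy
        have hx' : x.1 • α + x.2 • β = m := hx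
        rw [e1, e2, add_add_add_comm, hx'] at hy'
        simpa using hy'
      by_contra hne
      refine hrel _ _ ?_ h3
      by_contra! hcon
      exact hne (Prod.ext (by omega) (by omega))
end lin2

section torus
set_option linter.unusedSectionVars false
open MvPolynomial

lemma inj_of_surj_noeth {R : Type*} [CommRing R] [IsNoetherianRing R] (φ : R →+* R)
    (h : Function.Surjective φ) : Function.Injective φ := by
  have hs : ∀ n : ℕ, Function.Surjective ((φ ^ n : R →+* R) : R → R) := by
    intro n
    rw [RingHom.coe_pow]; exact h.iterate n
  let I : ℕ →o Ideal R := ⟨fun n => RingHom.ker (φ ^ n), by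
    refine monotone_nat_of_le_succ fun n x hx => ?_
    rw [RingHom.mem_ker] at *
    rw [pow_succ', RingHom.mul_def, RingHom.comp_apply, hx, map_zero]⟩
  obtain ⟨n, hn⟩ := monotone_stabilizes_iff_noetherian.2 ‹IsNoetherianRing R› I
  rw [injective_iff_map_eq_zero]
  intro x hx
  obtain ⟨y, rfl⟩ := hs n x
  have h1 : y ∈ I (n + 1) := by
    change y ∈ RingHom.ker (φ ^ (n + 1))
    rw [RingHom.mem_ker, pow_succ', RingHom.mul_def, RingHom.comp_apply, hx]
  rw [← hn (n + 1) (by omega)] at h1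
  exact h1

variable {K : Type*} [Field K] [IsAlgClosed K] {r : ℕ}

/-- The character of weight `m`. -/
def chi (m : Fin r → ℤ) : (Fin r → Kˣ) →* K where
  toFun t := ∏ j, ((t j ^ m j : Kˣ) : K)
  map_one' := by simp
  map_mul' s t := by
    rw [← Finset.prod_mul_distrib]
    refine Finset.prod_congr rfl fun j _ => ?_
    rw [Pi.mul_apply, mul_zpow, Units.val_mul]

lemma chi_apply (m : Fin r → ℤ) (t : Fin r → Kˣ) : chi m t = ∏ j, ((t j ^ m j : Kˣ) : K) := rfl

lemma chi_zero (t : Fin r → Kˣ) : chi (0 : Fin r → ℤ) t = 1 := by simp [chi_apply]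

lemma chi_add (m n : Fin r → ℤ) (t : Fin r → Kˣ) : chi (m + n) t = chi m t * chi n t := by
  simp only [chi_apply]
  rw [← Finset.prod_mul_distrib]
  refine Finset.prod_congr rfl fun j _ => ?_
  rw [Pi.add_apply, zpow_add, Units.val_mul]

lemma zpow_all_one_s12 {k : ℤ} (h : ∀ x : Kˣ, x ^ k = 1) : k = 0 := by
  classical
  by_contra hk
  have hn : 0 < k.natAbs := by omega
  have h' : ∀ x : Kˣ, x ^ k.natAbs = 1 := by
    intro x
    rcases Int.natAbs_eq k with e | e
    · rw [← zpow_natCast, ← e]; exact h x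
    · have := h x
      rw [e, zpow_neg, inv_eq_one, zpow_natCast] at this
      exact this
  obtain ⟨x, hx⟩ := Infinite.exists_notMem_finset
    (insert (0 : K) (Polynomial.nthRootsFinset k.natAbs (1 : K)))
  rw [Finset.mem_insert, not_or, Polynomial.mem_nthRootsFinset hn] at hx
  have := congrArg Units.val (h' (Units.mk0 x hx.1))
  exact hx.2 (by simpa using this)

lemma chi_inj : Function.Injective (chi (K := K) (r := r)) := by
  intro m n hmn
  funext j
  have : m j - n j = 0 := by
    apply zpow_all_one_s12 (K := K)
    intro x
    have h := DFunLike.congr_fun hmn (Pi.mulSingle j x)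
    have e : ∀ l : Fin r → ℤ, chi l (Pi.mulSingle j x) = ((x ^ l j : Kˣ) : K) := by
      intro l
      rw [chi_apply, Finset.prod_eq_single j]
      · simp
      · intro b _ hb; simp [Pi.mulSingle_eq_of_ne hb]
      · simp
    rw [e, e, Units.val_inj] at h
    rw [zpow_sub, h, mul_inv_cancel]
  omega

lemma chi_indep (S : Finset (Fin r → ℤ)) (F : (Fin r → ℤ) → MvPolynomial (Fin 2) K)
    (h : ∀ t : Fin r → Kˣ, ∑ m ∈ S, chi m t • F m = 0) : ∀ m ∈ S, F m = 0 := by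
  intro m hm
  ext d
  have hl := (linearIndependent_monoidHom (Fin r → Kˣ) K).comp _ (chi_inj (K := K) (r := r))
  rw [linearIndependent_iff'] at hl
  rw [coeff_zero]
  refine hl S (fun m => coeff d (F m)) ?_ m hm
  funext t
  have := congrArg (coeff d) (h t)
  rw [coeff_sum] at this
  simp only [coeff_smul, coeff_zero, smul_eq_mul] at this
  simp only [Function.comp, Finset.sum_apply, Pi.smul_apply, smul_eq_mul, Pi.zero_apply]
  rw [← this]
  exact Finset.sum_congr rfl fun _ _ => mul_comm _ _

/-- functions on the torus with values in polynomials that are Laurent polynomials. -/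
noncomputable def LS (K : Type*) [Field K] (r : ℕ) :
    Submodule K ((Fin r → Kˣ) → MvPolynomial (Fin 2) K) :=
  Submodule.span K {g | ∃ (m : Fin r → ℤ) (a : MvPolynomial (Fin 2) K), g = fun t => chi m t • a}

lemma LS_gen (m : Fin r → ℤ) (a : MvPolynomial (Fin 2) K) : (fun t => chi m t • a) ∈ LS K r :=
  Submodule.subset_span ⟨m, a, rfl⟩

lemma LS_mul {f g : (Fin r → Kˣ) → MvPolynomial (Fin 2) K} (hf : f ∈ LS K r) (hg : g ∈ LS K r) :
    f * g ∈ LS K r := by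
  have h1 : f * g ∈ LS K r * LS K r := Submodule.mul_mem_mul hf hg
  rw [LS, Submodule.span_mul_span] at h1
  refine Submodule.span_mono ?_ h1
  rintro _ ⟨_, ⟨m, a, rfl⟩, _, ⟨n, b, rfl⟩, rfl⟩
  refine ⟨m + n, a * b, ?_⟩
  funext t
  simp only [Pi.mul_apply, chi_add]
  rw [smul_mul_smul_comm]

lemma LS_extract {g : (Fin r → Kˣ) → MvPolynomial (Fin 2) K} (hg : g ∈ LS K r) :
    ∃ F : (Fin r → ℤ) →₀ MvPolynomial (Fin 2) K, ∀ t, g t = F.sum fun m a => chi m t • a := by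
  induction hg using Submodule.span_induction with
  | mem x hx =>
    obtain ⟨m, a, rfl⟩ := hx
    exact ⟨Finsupp.single m a, fun t => by
      rw [Finsupp.sum_single_index (h := fun m a => chi m t • a) (smul_zero _)]⟩
  | zero => exact ⟨0, fun t => by simp⟩
  | add x y _ _ hx hy =>
    obtain ⟨F, hF⟩ := hx
    obtain ⟨G, hG⟩ := hy
    refine ⟨F + G, fun t => ?_⟩
    rw [Finsupp.sum_add_index' (fun _ => smul_zero _) (fun _ _ _ => smul_add _ _ _), ← hF, ← hG]
    rfl
  | smul c x _ hx =>
    obtain ⟨F, hF⟩ := hx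
    refine ⟨c • F, fun t => ?_⟩
    rw [Finsupp.sum_smul_index' (fun _ => smul_zero _), Pi.smul_apply, hF, Finsupp.smul_sum]
    exact Finsupp.sum_congr fun _ _ => smul_comm _ _ _

/-- weight spaces -/
def wt (ρ : (Fin r → Kˣ) → MvPolynomial (Fin 2) K →ₐ[K] MvPolynomial (Fin 2) K)
    (m : Fin r → ℤ) : Submodule K (MvPolynomial (Fin 2) K) where
  carrier := {f | ∀ t, ρ t f = chi m t • f}
  add_mem' {a b} ha hb t := by rw [map_add, ha t, hb t, smul_add]
  zero_mem' t := by simp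
  smul_mem' c f hf t := by rw [map_smul, hf t, smul_comm]

lemma mem_wt {ρ : (Fin r → Kˣ) → MvPolynomial (Fin 2) K →ₐ[K] MvPolynomial (Fin 2) K}
    {m : Fin r → ℤ} {f} : f ∈ wt ρ m ↔ ∀ t, ρ t f = chi m t • f := Iff.rfl

instance wt_graded (ρ : (Fin r → Kˣ) → MvPolynomial (Fin 2) K →ₐ[K] MvPolynomial (Fin 2) K) :
    SetLike.GradedMonoid (wt ρ) where
  one_mem t := by rw [map_one, chi_zero, one_smul]
  mul_mem i j a b ha hb t := by rw [map_mul, ha t, hb t, chi_add, smul_mul_smul_comm]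

lemma wt_internal (ρ : (Fin r → Kˣ) → MvPolynomial (Fin 2) K →ₐ[K] MvPolynomial (Fin 2) K)
    (h1 : ∀ f, ρ 1 f = f) (h2 : ∀ s t f, ρ s (ρ t f) = ρ (s * t) f)
    (h3 : ∀ f, (fun t => ρ t f) ∈ LS K r) : DirectSum.IsInternal (wt ρ) := by
  classical
  constructor
  · rw [injective_iff_map_eq_zero]
    intro x hx
    rw [DirectSum.coeAddMonoidHom_eq_dfinsuppSum, DFinsupp.sum] at hx
    have h0 : ∀ t : Fin r → Kˣ, ∑ m ∈ x.support, chi m t • (x m : MvPolynomial (Fin 2) K) = 0 := by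
      intro t
      have := congrArg (ρ t) hx
      rw [map_sum, map_zero] at this
      rw [← this]
      exact Finset.sum_congr rfl fun m _ => ((x m).2 t).symm
    have h4 := chi_indep _ _ h0
    ext1 m
    by_contra hm
    exact hm (Subtype.ext (h4 m (DFinsupp.mem_support_iff.2 hm)))
  · intro f
    obtain ⟨F, hF⟩ := LS_extract (h3 f)
    have hw : ∀ m, F m ∈ wt ρ m := by
      intro m s
      by_cases hm : m ∈ F.support
      · rw [← sub_eq_zero]
        refine chi_indep F.support (fun m => ρ s (F m) - chi m s • F m) ?_ m hm
        intro t
        have e1 : ρ s (ρ t f) = ∑ m ∈ F.support, chi m t • ρ s (F m) := by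
          have := hF t
          rw [this, Finsupp.sum, map_sum]
          exact Finset.sum_congr rfl fun m _ => map_smul _ _ _
        have e2 : ρ (s * t) f = ∑ m ∈ F.support, chi m t • chi m s • F m := by
          have := hF (s * t)
          rw [this, Finsupp.sum]
          refine Finset.sum_congr rfl fun m _ => ?_
          rw [map_mul, smul_smul, mul_comm]
        simp only [smul_sub]
        rw [Finset.sum_sub_distrib, ← e1, ← e2, h2, sub_self]
      · rw [Finsupp.notMem_support_iff.1 hm]; simp
    refine ⟨∑ m ∈ F.support, DirectSum.of (fun m => wt ρ m) m ⟨F m, hw m⟩, ?_⟩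
    rw [map_sum]
    simp only [DirectSum.coeAddMonoidHom_of]
    have := hF 1
    simp only [h1, map_one, one_smul] at this
    exact this.symm

end torus

open MvPolynomial

/-- **(Gutwirth)** Any effective regular action of a torus `(Kˣ)^r` (`r ≥ 1`) on the
affine plane over an algebraically closed field is linearizable. -/
theorem torus_action_on_affine_plane_linearizable
    {K : Type*} [Field K] [IsAlgClosed K] (r : ℕ) (hr : 1 ≤ r)
    (σ : (Fin r → Kˣ) → (Fin 2 → K) → (Fin 2 → K))
    (hid : ∀ x, σ 1 x = x)
    (hcomp : ∀ t₁ t₂ x, σ t₁ (σ t₂ x) = σ (t₁ * t₂) x)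
    (hreg : IsRegularAffineAction σ)
    (heff : ∀ t, t ≠ 1 → ∃ x, σ t x ≠ x) :
    ∃ β γ : (Fin 2 → K) → (Fin 2 → K),
      IsPolyMap β ∧ IsPolyMap γ ∧ (∀ x, γ (β x) = x) ∧ (∀ x, β (γ x) = x) ∧
      ∀ t, ∃ A : Matrix (Fin 2) (Fin 2) K, ∀ x, γ (σ t (β x)) = A.mulVec x := by
  obtain ⟨P, hP⟩ := hreg
  let Q : Fin 2 → (Fin r → Kˣ) → MvPolynomial (Fin 2) K := fun i =>
    ∑ d ∈ (P i).support, ∑ m ∈ (P i d).support, fun t => chi m t • monomial d (P i d m)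
  have hQ : ∀ i, Q i ∈ LS K r := fun i =>
    Submodule.sum_mem _ fun d _ => Submodule.sum_mem _ fun m _ => LS_gen _ _
  have hQe : ∀ i t x, eval x (Q i t) = σ t x i := by
    intro i t x
    rw [hP, Finsupp.sum]
    simp only [Q, Finset.sum_apply, map_sum, lEval, Finsupp.sum, Finset.sum_mul]
    refine Finset.sum_congr rfl fun d _ => Finset.sum_congr rfl fun m _ => ?_
    rw [smul_eval, eval_monomial, chi_apply, Finsupp.prod_fintype _ _ (by simp)]
    ring
  let ρ : (Fin r → Kˣ) → MvPolynomial (Fin 2) K →ₐ[K] MvPolynomial (Fin 2) K := fun t =>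
    aeval fun i => Q i t
  have hρ : ∀ t x f, eval x (ρ t f) = eval (σ t x) f := by
    intro t x f
    induction f using MvPolynomial.induction_on with
    | C a => simp [ρ]
    | add f g hf hg => simp [hf, hg]
    | mul_X f i hf =>
      rw [map_mul, map_mul, hf, map_mul, eval_X, ← hQe]
      simp [ρ]
  have h1 : ∀ f, ρ 1 f = f := fun f => MvPolynomial.funext fun x => by rw [hρ, hid]
  have h2 : ∀ s t f, ρ s (ρ t f) = ρ (s * t) f := fun s t f => MvPolynomial.funext fun x => by
    rw [hρ, hρ, hρ, hcomp, mul_comm]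
  have h3 : ∀ f, (fun t => ρ t f) ∈ LS K r := by
    intro f
    induction f using MvPolynomial.induction_on with
    | C a =>
      convert LS_gen (K := K) (r := r) 0 (C a) using 1
      funext t
      rw [chi_zero, one_smul]; simp [ρ]
    | add f g hf hg =>
      convert Submodule.add_mem _ hf hg using 1
      funext t; simp
    | mul_X f i hf =>
      convert LS_mul hf (hQ i) using 1
      funext t; simp [ρ]
  let inst : GradedAlgebra (wt ρ) := (wt_internal ρ h1 h2 h3).gradedAlgebra
  obtain ⟨u, v, α, β, hu, hv, htop⟩ := graded_plane (wt ρ)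
  let w : Fin 2 → MvPolynomial (Fin 2) K := ![u, v]
  let θ : MvPolynomial (Fin 2) K →ₐ[K] MvPolynomial (Fin 2) K := aeval w
  have hsurj : Function.Surjective θ := by
    rw [← AlgHom.range_eq_top, ← htop, ← Algebra.adjoin_range_eq_range_aeval]
    congr 1
    simp [w, Matrix.range_cons, Matrix.range_empty, Set.pair_comm]
  have hinj : Function.Injective θ := inj_of_surj_noeth θ.toRingHom hsurj
  choose b hb using fun i : Fin 2 => hsurj (X i)
  let θ' : MvPolynomial (Fin 2) K →ₐ[K] MvPolynomial (Fin 2) K := aeval b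
  have hcomp1 : θ.comp θ' = AlgHom.id K _ := by
    apply MvPolynomial.algHom_ext
    intro i
    simp [θ', hb]
  have hcomp2 : ∀ f, θ' (θ f) = f := fun f => hinj (DFunLike.congr_fun hcomp1 (θ f))
  have hev : ∀ (z : Fin 2 → MvPolynomial (Fin 2) K) x f,
      eval x (aeval z f) = eval (fun i => eval x (z i)) f := by
    intro z x f
    induction f using MvPolynomial.induction_on with
    | C a => simp
    | add f g hf hg => rw [map_add, map_add, map_add, hf, hg]
    | mul_X f i hf => rw [map_mul, map_mul, hf, map_mul, eval_X, aeval_X]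
  have hgb : ∀ (x : Fin 2 → K) j, eval (fun i => eval x (b i)) (w j) = x j := by
    intro x j
    rw [← hev b]
    have := hcomp2 (X j)
    simp only [θ, aeval_X] at this
    change eval x (θ' (w j)) = _
    rw [this, eval_X]
  refine ⟨fun x i => eval x (b i), fun x i => eval x (w i), ⟨b, fun _ _ => rfl⟩, ⟨w, fun _ _ => rfl⟩,
    ?_, ?_, ?_⟩
  · intro x
    funext j
    exact hgb x j
  · intro x
    funext j
    change eval (fun i => eval x (w i)) (b j) = x j
    rw [← hev w]
    change eval x (θ (b j)) = _
    rw [hb, eval_X]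
  · intro t
    refine ⟨Matrix.diagonal ![chi α t, chi β t], fun x => ?_⟩
    funext j
    rw [Matrix.mulVec_diagonal]
    change eval (σ t fun i => eval x (b i)) (w j) = _
    have hw : ρ t (w j) = (![chi α t, chi β t] j : K) • w j := by
      fin_cases j
      · exact hu t
      · exact hv t
    rw [← hρ, hw, smul_eval, hgb]
end
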